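/- arXiv:1602.06094 — 5 statements merged into one kernel-verified Lean document; each statement's English description precedes it below -/
import Mathlib

section
/- Let R be a Bézout duo-domain. Then R is an elementary divisor ring if and only if for all a, b, c ∈ R with aR + bR + cR = R there exist p, q ∈ R such that (pa + qb)R + qcR = R. -/
/-- A (not necessarily square) matrix `A` over a ring admits diagonal reduction if there are
invertible matrices `P`, `Q` such that `P * A * Q` is a diagonal matrix `(d_ij)` in which each
diagonal entry `d_{i+1,i+1}` is a full divisor of `d_ii`, i.e.
`R·d_{i+1,i+1}·R ⊆ d_ii·R ∩ R·d_ii`. -/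
def AdmitsDiagonalReduction {R : Type*} [Ring R] {m n : ℕ}
    (A : Matrix (Fin m) (Fin n) R) : Prop :=
  ∃ (P : Matrix (Fin m) (Fin m) R) (Q : Matrix (Fin n) (Fin n) R),
    IsUnit P ∧ IsUnit Q ∧
    (∀ (i : Fin m) (j : Fin n), (i : ℕ) ≠ (j : ℕ) → (P * A * Q) i j = 0) ∧
    (∀ (i : Fin m) (j : Fin n) (i' : Fin m) (j' : Fin n),
      (i : ℕ) = (j : ℕ) → (i' : ℕ) = (j' : ℕ) → (i' : ℕ) = (i : ℕ) + 1 →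
      ∀ x y : R,
        (∃ u : R, x * (P * A * Q) i' j' * y = (P * A * Q) i j * u) ∧
        (∃ v : R, x * (P * A * Q) i' j' * y = v * (P * A * Q) i j))

/-- A ring is an elementary divisor ring if every matrix admits a diagonal reduction. -/
def ElementaryDivisorRing (R : Type*) [Ring R] : Prop :=
  ∀ (m n : ℕ) (A : Matrix (Fin m) (Fin n) R), AdmitsDiagonalReduction A

/-- A ring is Bézout if every finitely generated left ideal and every finitely generated
right ideal is principal. (Right ideals are submodules of `R` over `Rᵐᵒᵖ`.) -/
def IsBezoutRing (R : Type*) [Ring R] : Prop :=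
  (∀ I : Ideal R, I.FG → ∃ d : R, I = Ideal.span {d}) ∧
  (∀ I : Submodule Rᵐᵒᵖ R, I.FG → ∃ d : R, I = Submodule.span Rᵐᵒᵖ {d})

/-- A ring is duo if every left ideal and every right ideal is two-sided. -/
def IsDuoRing (R : Type*) [Ring R] : Prop :=
  (∀ (I : Ideal R), ∀ a ∈ I, ∀ r : R, a * r ∈ I) ∧
  (∀ (I : Submodule Rᵐᵒᵖ R), ∀ a ∈ I, ∀ r : R, r * a ∈ I)

/-- A ring is left quasi-duo if every maximal left ideal is two-sided. -/
def IsLeftQuasiDuo (R : Type*) [Ring R] : Prop :=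
  ∀ I : Ideal R, I.IsMaximal → ∀ a ∈ I, ∀ r : R, a * r ∈ I

/-- A ring is right quasi-duo if every maximal right ideal is two-sided. -/
def IsRightQuasiDuo (R : Type*) [Ring R] : Prop :=
  ∀ I : Submodule Rᵐᵒᵖ R, IsCoatom I → ∀ a ∈ I, ∀ r : R, r * a ∈ I

/-- A ring has stable range 1 if `aR + bR = R` implies `a + by` is a unit for some `y`. -/
def HasStableRange1 (R : Type*) [Ring R] : Prop :=
  ∀ a b : R, (∃ x y : R, a * x + b * y = 1) → ∃ y : R, IsUnit (a + b * y)

/-- The quotient ring `R/aR`, where `aR` is regarded as the two-sided ideal generated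
by `a` (in a duo ring this coincides with the right ideal `aR`). -/
abbrev QuotBy {R : Type*} [Ring R] (a : R) : Type _ :=
  (TwoSidedIdeal.span {a}).ringCon.Quotient

/-- The Jacobson radical of `R` (the intersection of all maximal left ideals). -/
noncomputable abbrev jacobsonRadical (R : Type*) [Ring R] : Ideal R :=
  Ideal.jacobson (⊥ : Ideal R)

/-- A two-sided ideal `P` is prime if `P ≠ R` and `aRb ⊆ P` implies `a ∈ P` or `b ∈ P`. -/
def IsPrimeTwoSided {R : Type*} [Ring R] (P : TwoSidedIdeal R) : Prop :=
  P ≠ ⊤ ∧ ∀ a b : R, (∀ r : R, a * r * b ∈ P) → a ∈ P ∨ b ∈ P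

/-- A ring is a PM ring if every prime two-sided ideal is contained in exactly one
maximal (two-sided) ideal. -/
def IsPMRing (R : Type*) [Ring R] : Prop :=
  ∀ P : TwoSidedIdeal R, IsPrimeTwoSided P →
    ∃! M : TwoSidedIdeal R, IsCoatom M ∧ P ≤ M

/-- An element `c` is adequate if for every `a` there are `r, s` with `c = rs`,
`rR + aR = R`, and `s'R + aR ≠ R` for every non-invertible divisor `s'` of `s`. -/
def IsAdequateElement {R : Type*} [Ring R] (c : R) : Prop :=
  ∀ a : R, ∃ r s : R, c = r * s ∧ (∃ x y : R, r * x + a * y = 1) ∧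
    ∀ s' : R, ¬ IsUnit s' → (∃ u : R, s = s' * u) → ¬ ∃ x y : R, s' * x + a * y = 1

/-- An element `c` is feckly adequate if for every `a` there are `r, s` with
`c ≡ rs (mod J(R))`, `rR + aR = R`, and `s'R + aR ≠ R` for every non-invertible
divisor `s'` of `s`. -/
def IsFecklyAdequateElement {R : Type*} [Ring R] (c : R) : Prop :=
  ∀ a : R, ∃ r s : R, c - r * s ∈ jacobsonRadical R ∧ (∃ x y : R, r * x + a * y = 1) ∧
    ∀ s' : R, ¬ IsUnit s' → (∃ u : R, s = s' * u) → ¬ ∃ x y : R, s' * x + a * y = 1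



namespace BezoutDuo

open Matrix

section
variable {R : Type*} [Ring R]

lemma duo_right (hD : IsDuoRing R) (a r : R) : ∃ s, r * a = a * s := by
  have h := hD.2 (Submodule.span Rᵐᵒᵖ {a}) a (Submodule.mem_span_singleton_self a) r
  obtain ⟨s, hs⟩ := Submodule.mem_span_singleton.1 h
  exact ⟨s.unop, by rw [← hs]; rfl⟩

lemma duo_left (hD : IsDuoRing R) (a r : R) : ∃ s, a * r = s * a := by
  have h := hD.1 (Ideal.span {a}) a (Ideal.mem_span_singleton_self a) r
  obtain ⟨s, hs⟩ := Ideal.mem_span_singleton'.1 h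
  exact ⟨s, hs.symm⟩

lemma dvd_mul_l (hD : IsDuoRing R) {d a : R} (h : d ∣ a) (r : R) : d ∣ r * a := by
  obtain ⟨u, rfl⟩ := h
  obtain ⟨s, hs⟩ := duo_right hD d r
  exact ⟨s * u, by rw [← mul_assoc, hs, mul_assoc]⟩

/-- right gcd of a finite family -/
lemma gcd_fam (hB : IsBezoutRing R) {ι : Type*} [Fintype ι] (f : ι → R) :
    ∃ z : ι → R, ∀ i, (∑ j, f j * z j) ∣ f i := by
  obtain ⟨d, hd⟩ := hB.2 (Submodule.span Rᵐᵒᵖ (Set.range f))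
    (Submodule.fg_span (Set.finite_range f))
  have h1 : d ∈ Submodule.span Rᵐᵒᵖ (Set.range f) := by
    rw [hd]; exact Submodule.mem_span_singleton_self d
  obtain ⟨c, hc⟩ := (Submodule.mem_span_range_iff_exists_fun _).1 h1
  refine ⟨fun j => (c j).unop, fun i => ?_⟩
  have h2 : f i ∈ Submodule.span Rᵐᵒᵖ {d} := by
    rw [← hd]; exact Submodule.subset_span ⟨i, rfl⟩
  obtain ⟨s, hs⟩ := Submodule.mem_span_singleton.1 h2
  have h3 : ∑ j, f j * (c j).unop = d := by rw [← hc]; rfl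
  rw [h3]
  exact ⟨s.unop, by rw [← hs]; rfl⟩

lemma gcd_left (hB : IsBezoutRing R) (x y : R) :
    ∃ g a b s t : R, g = a * x + b * y ∧ x = s * g ∧ y = t * g := by
  obtain ⟨g, hg⟩ := hB.1 (Ideal.span {x, y}) (Submodule.fg_span (by simp))
  have h1 : g ∈ Ideal.span {x, y} := by rw [hg]; exact Ideal.mem_span_singleton_self g
  have hx : x ∈ Ideal.span {g} := by rw [← hg]; exact Ideal.subset_span (by simp)
  have hy : y ∈ Ideal.span {g} := by rw [← hg]; exact Ideal.subset_span (by simp)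
  obtain ⟨a, b, hab⟩ := Ideal.mem_span_pair.1 h1
  obtain ⟨s, hs⟩ := Ideal.mem_span_singleton'.1 hx
  obtain ⟨t, ht⟩ := Ideal.mem_span_singleton'.1 hy
  exact ⟨g, a, b, s, t, hab.symm, hs.symm, ht.symm⟩

end

section
variable {R : Type*} [Ring R] [IsDomain R]

lemma mul_one_comm' {a b : R} (h : a * b = 1) : b * a = 1 := by
  have hb : a ≠ 0 := by rintro rfl; simp at h
  apply mul_left_cancel₀ hb
  rw [← mul_assoc, h]; simp

/-- two by two unimodular completion -/
lemma complete_two (hB : IsBezoutRing R) {a b s t : R} (h : a * s + b * t = 1) :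
    ∃ U : Matrix (Fin 2) (Fin 2) R, IsUnit U ∧ U 0 0 = a ∧ U 0 1 = b ∧
      U 1 0 * s + U 1 1 * t = 0 := by
  suffices H : ∃ α β u v : R, a * u + b * v = 0 ∧ s * a + u * α = 1 ∧ s * b + u * β = 0 ∧
      t * a + v * α = 0 ∧ t * b + v * β = 1 ∧ α * s + β * t = 0 ∧ α * u + β * v = 1 by
    obtain ⟨α, β, u, v, h1, h2, h3, h4, h5, h6, h7⟩ := H
    refine ⟨!![a, b; α, β], ⟨⟨!![a, b; α, β], !![s, u; t, v], ?_, ?_⟩, rfl⟩, rfl, rfl, h6⟩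
    · ext i j; fin_cases i <;> fin_cases j <;> simp [Matrix.mul_apply, *]
    · ext i j; fin_cases i <;> fin_cases j <;> simp [Matrix.mul_apply, *]
  by_cases hb : b = 0
  · subst hb
    have h' : a * s = 1 := by simpa using h
    have h'' := mul_one_comm' h'
    refine ⟨-(t * a), 1, 0, 1, ?_, ?_, ?_, ?_, ?_, ?_, ?_⟩ <;> simp [h'', mul_assoc, h']
  · obtain ⟨z, hz⟩ := gcd_fam hB ![1 - s * a, - (s * b)]
    simp only [Fin.sum_univ_two, Fin.forall_fin_two, Matrix.cons_val_zero, Matrix.cons_val_one] at hz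
    set u := (1 - s * a) * z 0 + -(s * b) * z 1 with hu
    set v := -(t * a) * z 0 + (1 - t * b) * z 1 with hv
    obtain ⟨⟨α, hα⟩, ⟨β, hβ⟩⟩ := hz
    have k1 : a * (1 - s * a) + b * (-(t * a)) = 0 := by
      have : a * (1 - s * a) + b * (-(t * a)) = a - (a * s + b * t) * a := by noncomm_ring
      rw [this, h]; simp
    have k2 : a * (-(s * b)) + b * (1 - t * b) = 0 := by
      have : a * (-(s * b)) + b * (1 - t * b) = b - (a * s + b * t) * b := by noncomm_ring
      rw [this, h]; simp
    have k3 : a * u + b * v = 0 := by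
      have : a * u + b * v = (a * (1 - s * a) + b * (-(t * a))) * z 0
        + (a * (-(s * b)) + b * (1 - t * b)) * z 1 := by rw [hu, hv]; noncomm_ring
      rw [this, k1, k2]; simp
    clear_value u v
    have k4 : v * α = -(t * a) := by
      apply mul_left_cancel₀ hb
      have e1 : b * (v * α) = (a * u + b * v) * α - a * (u * α) := by noncomm_ring
      rw [e1, k3, ← hα, zero_mul, zero_sub]
      exact neg_eq_of_add_eq_zero_right k1
    have k5 : v * β = 1 - t * b := by
      apply mul_left_cancel₀ hb
      have e1 : b * (v * β) = (a * u + b * v) * β - a * (u * β) := by noncomm_ring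
      rw [e1, k3, ← hβ, zero_mul, zero_sub]
      exact neg_eq_of_add_eq_zero_right k2
    have k6 : u * (α * s + β * t) = 0 := by
      have : u * (α * s + β * t) = (u * α) * s + (u * β) * t := by noncomm_ring
      rw [this, ← hα, ← hβ]
      have : (1 - s * a) * s + -(s * b) * t = s - s * (a * s + b * t) := by noncomm_ring
      rw [this, h]; simp
    have k7 : v * (α * s + β * t) = 0 := by
      have : v * (α * s + β * t) = (v * α) * s + (v * β) * t := by noncomm_ring
      rw [this, k4, k5]
      have : -(t * a) * s + (1 - t * b) * t = t - t * (a * s + b * t) := by noncomm_ring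
      rw [this, h]; simp
    have k8 : u * (α * u + β * v - 1) = 0 := by
      have : u * (α * u + β * v - 1) = (u * α) * u + (u * β) * v - u := by noncomm_ring
      rw [this, ← hα, ← hβ]
      have : (1 - s * a) * u + -(s * b) * v - u = - s * (a * u + b * v) := by noncomm_ring
      rw [this, k3]; simp
    have k9 : v * (α * u + β * v - 1) = 0 := by
      have : v * (α * u + β * v - 1) = (v * α) * u + (v * β) * v - v := by noncomm_ring
      rw [this, k4, k5]
      have : -(t * a) * u + (1 - t * b) * v - v = - t * (a * u + b * v) := by noncomm_ring
      rw [this, k3]; simp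
    have huv : u ≠ 0 ∨ v ≠ 0 := by
      by_contra hcon
      push Not at hcon
      obtain ⟨rfl, rfl⟩ := hcon
      have e1 : s * b = 0 := by simpa using hβ
      have e2 : t * b = 1 := by
        have := k5; rw [zero_mul] at this; exact (sub_eq_zero.1 this.symm).symm
      have e3 : s = 0 := (mul_eq_zero.1 e1).resolve_right hb
      have := hα
      simp [e3] at this
    have k10 : α * s + β * t = 0 := by
      rcases huv with hh | hh
      · exact (mul_eq_zero.1 k6).resolve_left hh
      · exact (mul_eq_zero.1 k7).resolve_left hh
    have k11 : α * u + β * v - 1 = 0 := by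
      rcases huv with hh | hh
      · exact (mul_eq_zero.1 k8).resolve_left hh
      · exact (mul_eq_zero.1 k9).resolve_left hh
    refine ⟨α, β, u, v, k3, ?_, ?_, ?_, ?_, k10, sub_eq_zero.1 k11⟩
    · rw [← hα]; abel
    · rw [← hβ]; abel
    · rw [k4]; abel
    · rw [k5]; abel

end

section
variable {R : Type*} [Ring R]

/-- block diagonal extension -/
def ext {m n : ℕ} (d : R) (B : Matrix (Fin m) (Fin n) R) :
    Matrix (Fin (m + 1)) (Fin (n + 1)) R :=
  Matrix.of (Fin.cons (Fin.cons d 0) (fun i => Fin.cons 0 (B i)))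

@[simp] lemma ext_zero_zero {m n : ℕ} (d : R) (B : Matrix (Fin m) (Fin n) R) :
    ext d B 0 0 = d := rfl
@[simp] lemma ext_zero_succ {m n : ℕ} (d : R) (B : Matrix (Fin m) (Fin n) R) (j : Fin n) :
    ext d B 0 j.succ = 0 := rfl
@[simp] lemma ext_succ_zero {m n : ℕ} (d : R) (B : Matrix (Fin m) (Fin n) R) (i : Fin m) :
    ext d B i.succ 0 = 0 := rfl
@[simp] lemma ext_succ_succ {m n : ℕ} (d : R) (B : Matrix (Fin m) (Fin n) R)
    (i : Fin m) (j : Fin n) : ext d B i.succ j.succ = B i j := rfl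

lemma ext_mul {m n k : ℕ} (d e : R) (B : Matrix (Fin m) (Fin n) R)
    (C : Matrix (Fin n) (Fin k) R) : ext d B * ext e C = ext (d * e) (B * C) := by
  ext i j
  refine Fin.cases ?_ (fun i => ?_) i <;> refine Fin.cases ?_ (fun j => ?_) j <;>
    simp [Matrix.mul_apply, Fin.sum_univ_succ]

lemma ext_one (m : ℕ) : ext (1 : R) (1 : Matrix (Fin m) (Fin m) R) = 1 := by
  ext i j
  refine Fin.cases ?_ (fun i => ?_) i <;> refine Fin.cases ?_ (fun j => ?_) j <;>
    simp [Matrix.one_apply, Fin.succ_ne_zero, (Fin.succ_ne_zero _).symm]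

lemma ext_isUnit {m : ℕ} {U : Matrix (Fin m) (Fin m) R} (h : IsUnit U) :
    IsUnit (ext 1 U) := by
  obtain ⟨u, rfl⟩ := h
  exact ⟨⟨ext 1 u, ext 1 ↑u⁻¹, by rw [ext_mul]; simp [ext_one],
    by rw [ext_mul]; simp [ext_one]⟩, rfl⟩

lemma perm_unit {m : ℕ} (σ : Equiv.Perm (Fin m)) :
    ∃ W : Matrix (Fin m) (Fin m) R, IsUnit W ∧ (∀ v : Fin m → R, W *ᵥ v = v ∘ σ) ∧
      ∀ v : Fin m → R, (v ∘ σ) ᵥ* W = v := by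
  have key : ∀ σ : Equiv.Perm (Fin m), (1 : Matrix (Fin m) (Fin m) R).submatrix σ id *
      (1 : Matrix (Fin m) (Fin m) R).submatrix σ.symm id = 1 := by
    intro σ
    ext i j
    simp [Matrix.mul_apply, Matrix.one_apply, Equiv.symm_apply_eq]
  refine ⟨(1 : Matrix (Fin m) (Fin m) R).submatrix σ id,
    ⟨⟨_, (1 : Matrix (Fin m) (Fin m) R).submatrix σ.symm id, key σ, key σ.symm⟩, rfl⟩, ?_, ?_⟩
  · intro v; ext i; simp [Matrix.mulVec, dotProduct, Matrix.one_apply]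
  · intro v; ext i
    change ∑ k, v (σ k) * (1 : Matrix (Fin m) (Fin m) R) (σ k) i = v i
    rw [Equiv.sum_comp σ (fun k => v k * (1 : Matrix (Fin m) (Fin m) R) k i)]
    simp [Matrix.one_apply]

end

section
variable {R : Type*} [Ring R] [IsDomain R]

lemma kill_coord (hB : IsBezoutRing R) (m : ℕ) (x : Fin (m + 2) → R) :
    ∃ U : Matrix (Fin (m + 2)) (Fin (m + 2)) R, IsUnit U ∧ ∃ i, (U *ᵥ x) i = 0 := by
  induction m with
  | zero =>
    obtain ⟨g, a, b, s, t, hg, hs, ht⟩ := gcd_left hB (x 0) (x 1)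
    by_cases h0 : g = 0
    · exact ⟨1, isUnit_one, 0, by simp [hs, h0]⟩
    have h1 : a * s + b * t = 1 := by
      apply mul_right_cancel₀ h0
      rw [add_mul, mul_assoc, mul_assoc, ← hs, ← ht, ← hg, one_mul]
    obtain ⟨U, hU, h00, h01, h10⟩ := complete_two hB h1
    refine ⟨U, hU, 1, ?_⟩
    change ∑ k : Fin 2, U 1 k * x k = 0
    rw [Fin.sum_univ_two]
    rw [hs, ht, ← mul_assoc, ← mul_assoc, ← add_mul, h10, zero_mul]
  | succ m ih =>
    obtain ⟨U, hU, i, hi⟩ := ih (fun j => x j.succ)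
    refine ⟨ext 1 U, ext_isUnit hU, i.succ, ?_⟩
    simp only [Matrix.mulVec, dotProduct] at hi ⊢
    rw [Fin.sum_univ_succ]
    simpa using hi

lemma kill_zero (hB : IsBezoutRing R) (m : ℕ) (x : Fin (m + 2) → R) :
    ∃ U : Matrix (Fin (m + 2)) (Fin (m + 2)) R, IsUnit U ∧ (U *ᵥ x) 0 = 0 := by
  obtain ⟨U, hU, i, hi⟩ := kill_coord hB m x
  obtain ⟨W, hW, hWv, -⟩ := perm_unit (R := R) (Equiv.swap 0 i)
  refine ⟨W * U, hW.mul hU, ?_⟩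
  rw [← Matrix.mulVec_mulVec, hWv]
  simpa using hi

lemma complete (hB : IsBezoutRing R) (m : ℕ) (p x : Fin (m + 1) → R) (h : p ⬝ᵥ x = 1) :
    ∃ U : Matrix (Fin (m + 1)) (Fin (m + 1)) R, IsUnit U ∧
      (Pi.single 0 1) ᵥ* U = p ∧ U *ᵥ x = Pi.single 0 1 := by
  induction m with
  | zero =>
    have h' : p 0 * x 0 = 1 := by simpa [dotProduct] using h
    have h'' := mul_one_comm' h'
    refine ⟨Matrix.of fun _ _ => p 0, ⟨⟨Matrix.of fun _ _ => p 0, Matrix.of fun _ _ => x 0,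
      ?_, ?_⟩, rfl⟩, ?_, ?_⟩
    · ext i j; fin_cases i; fin_cases j; simp [Matrix.mul_apply, h']
    · ext i j; fin_cases i; fin_cases j; simp [Matrix.mul_apply, h'']
    · ext i; fin_cases i; simp [Matrix.vecMul, dotProduct]
    · ext i; fin_cases i; simp [Matrix.mulVec, dotProduct, h']
  | succ m ih =>
    -- reduce to x 0 = 0
    suffices H : ∀ p x : Fin (m + 2) → R, p ⬝ᵥ x = 1 → x 0 = 0 →
        ∃ U : Matrix (Fin (m + 2)) (Fin (m + 2)) R, IsUnit U ∧
        (Pi.single 0 1) ᵥ* U = p ∧ U *ᵥ x = Pi.single 0 1 by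
      obtain ⟨V, ⟨V, rfl⟩, hV⟩ := kill_zero hB m x
      obtain ⟨U, hU, h1, h2⟩ := H (p ᵥ* (↑V⁻¹ : Matrix _ _ R)) ((V : Matrix _ _ R) *ᵥ x)
        (by rw [Matrix.dotProduct_mulVec, Matrix.vecMul_vecMul]; simpa using h) hV
      refine ⟨U * V, hU.mul V.isUnit, ?_, ?_⟩
      · rw [← Matrix.vecMul_vecMul, h1, Matrix.vecMul_vecMul]; simp
      · rw [← Matrix.mulVec_mulVec, h2]
    clear h p x
    intro p x h hx
    have hs : (fun j => p (Fin.succ j)) ⬝ᵥ (fun j => x (Fin.succ j)) = 1 := by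
      simpa [dotProduct, Fin.sum_univ_succ (n := m + 1), hx] using h
    obtain ⟨U, hU, h1, h2⟩ := ih _ _ hs
    obtain ⟨W, hW, hW1, hW2⟩ := perm_unit (R := R) (m := m + 2) (Equiv.swap 0 1)
    -- transvection
    let N : Matrix (Fin (m + 2)) (Fin (m + 2)) R := Matrix.vecMulVec x (Pi.single 0 (p 0))
    have hN : N * N = 0 := by
      simp only [N]
      ext i j
      simp [Matrix.mul_apply, Matrix.vecMulVec_apply, Fin.sum_univ_succ (n := m + 1), hx]
    have hT : IsUnit (1 + N) := by
      refine ⟨⟨1 + N, 1 - N, ?_, ?_⟩, rfl⟩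
      · simp [mul_sub, add_mul, hN]
      · simp [mul_add, sub_mul, hN]
    have hNx : N *ᵥ x = 0 := by
      ext i
      simp [N, Matrix.mulVec, dotProduct, Matrix.vecMulVec_apply,
        Fin.sum_univ_succ (n := m + 1), hx]
    have hEx : (ext 1 U) *ᵥ x = Pi.single 1 1 := by
      ext i
      refine Fin.cases ?_ (fun i => ?_) i
      · simp [Matrix.mulVec, dotProduct, Fin.sum_univ_succ (n := m + 1), hx]
      · have := congrFun h2 i
        simp only [Matrix.mulVec, dotProduct] at this
        simp only [Matrix.mulVec, dotProduct, Fin.sum_univ_succ (n := m + 1), hx,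
          ext_succ_succ, mul_zero, zero_add, this]
        simp only [Pi.single_apply]
        congr 1
        rw [← Fin.succ_zero_eq_one, Fin.succ_inj]
    have hpE : (Pi.single 1 1) ᵥ* (ext 1 U) = Fin.cons 0 (fun j => p (Fin.succ j)) := by
      ext i
      refine Fin.cases ?_ (fun i => ?_) i
      · rw [Matrix.single_one_vecMul]
        exact ext_succ_zero 1 U 0
      · have := congrFun h1 i
        rw [Matrix.single_one_vecMul] at this ⊢
        exact (ext_succ_succ 1 U 0 i).trans this
    refine ⟨W * (ext 1 U) * (1 + N), (hW.mul (ext_isUnit hU)).mul hT, ?_, ?_⟩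
    · have e : (Pi.single 0 1 : Fin (m + 2) → R) = Pi.single 1 1 ∘ (Equiv.swap 0 1) := by
        ext i
        simp only [Pi.single_apply, Function.comp]
        congr 1
        rw [Equiv.swap_apply_eq_iff]; simp
      rw [← Matrix.vecMul_vecMul, ← Matrix.vecMul_vecMul, e, hW2, hpE, Matrix.vecMul_add,
        Matrix.vecMul_one]
      ext i
      refine Fin.cases ?_ (fun i => ?_) i
      · have e2 : ∑ j : Fin (m + 1), p j.succ * x j.succ = 1 := hs
        simp [N, Matrix.vecMul, dotProduct, Matrix.vecMulVec_apply,
          Fin.sum_univ_succ (n := m + 1), hx, ← mul_assoc, ← Finset.sum_mul, e2]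
      · simp [N, Matrix.vecMul, dotProduct, Matrix.vecMulVec_apply]
    · rw [← Matrix.mulVec_mulVec, ← Matrix.mulVec_mulVec, Matrix.add_mulVec, hNx,
        Matrix.one_mulVec, add_zero, hEx, hW1]
      ext i
      simp only [Pi.single_apply, Function.comp]
      congr 1
      rw [Equiv.swap_apply_eq_iff]; simp

/-- the condition in a homogeneous form -/
lemma cond_hom (hB : IsBezoutRing R) (hD : IsDuoRing R)
    (hc : ∀ a b c : R, (∃ x y z : R, a * x + b * y + c * z = 1) →
        ∃ p q : R, ∃ x y : R, (p * a + q * b) * x + (q * c) * y = 1) (a b c : R) :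
    ∃ p q x y g : R, (p * a + q * b) * x + (q * c) * y = g ∧ g ∣ a ∧ g ∣ b ∧ g ∣ c := by
  obtain ⟨z, hz⟩ := gcd_fam hB ![a, b, c]
  simp only [Fin.forall_fin_succ, Fin.sum_univ_three] at hz
  obtain ⟨h1, h2, h3, -⟩ := hz
  simp at h1 h2 h3
  obtain ⟨g, hg⟩ : ∃ g, g = a * z 0 + b * z 1 + c * z 2 := ⟨_, rfl⟩
  rw [← hg] at h1 h2 h3
  by_cases g0 : g = 0
  · exact ⟨0, 0, 0, 0, g, by simp [g0], h1, h2, h3⟩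
  refine (?_ : ∃ p q x y : R, _).elim fun p ⟨q, x, y, h⟩ => ⟨p, q, x, y, g, h, h1, h2, h3⟩
  obtain ⟨a0, rfl⟩ := h1
  obtain ⟨b0, rfl⟩ := h2
  obtain ⟨c0, rfl⟩ := h3
  obtain ⟨p, q, x, y, h⟩ := hc a0 b0 c0 ⟨z 0, z 1, z 2, by
    apply mul_left_cancel₀ g0
    rw [mul_one]; conv_rhs => rw [hg]
    noncomm_ring⟩
  obtain ⟨p', hp⟩ := duo_left hD g p
  obtain ⟨q', hq⟩ := duo_left hD g q
  refine ⟨p', q', x, y, ?_⟩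
  rw [← mul_assoc, ← mul_assoc, ← mul_assoc, ← hp, ← hq]
  calc _ = g * ((p * a0 + q * b0) * x + (q * c0) * y) := by noncomm_ring
    _ = g := by rw [h, mul_one]

lemma represent (hB : IsBezoutRing R) (hD : IsDuoRing R)
    (hc : ∀ a b c : R, (∃ x y z : R, a * x + b * y + c * z = 1) →
        ∃ p q : R, ∃ x y : R, (p * a + q * b) * x + (q * c) * y = 1)
    (n m : ℕ) (A : Matrix (Fin m) (Fin n) R) :
    ∃ (p : Fin m → R) (q : Fin n → R), ∀ i j, (p ᵥ* A) ⬝ᵥ q ∣ A i j := by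
  induction m with
  | zero => exact ⟨0, 0, fun i => i.elim0⟩
  | succ m ih =>
    obtain ⟨p', q', h'⟩ := ih (fun i => A i.succ)
    obtain ⟨w, hw⟩ : ∃ w, w = p' ᵥ* (fun i => A i.succ : Matrix (Fin m) (Fin n) R) := ⟨_, rfl⟩
    obtain ⟨d, hd⟩ : ∃ d, d = w ⬝ᵥ q' := ⟨_, rfl⟩
    rw [← hw, ← hd] at h'
    have hcons : ∀ s t : R, (Fin.cons s (fun i => t * p' i) : Fin (m + 1) → R) ᵥ* A =
        fun j => s * A 0 j + t * w j := by
      intro s t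
      ext j
      simp [hw, Matrix.vecMul, dotProduct, Fin.sum_univ_succ, Finset.mul_sum, mul_assoc]
    by_cases d0 : d = 0
    · obtain ⟨z, hz⟩ := gcd_fam hB (fun j => A 0 j)
      refine ⟨Fin.cons 1 (fun i => 0 * p' i), z, ?_⟩
      rw [hcons]
      intro i j
      refine Fin.cases ?_ (fun i => ?_) i
      · simpa [dotProduct] using hz j
      · have := h' i j
        rw [d0, zero_dvd_iff] at this
        rw [this]; exact dvd_zero _
    · have hdw : ∀ j, d ∣ w j := by
        intro j
        rw [hw]
        change d ∣ ∑ i, p' i * A i.succ j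
        exact Finset.dvd_sum fun i _ => dvd_mul_l hD (h' i j) _
      choose w0 hw0 using hdw
      have hw0q : w0 ⬝ᵥ q' = 1 := by
        apply mul_left_cancel₀ d0
        conv_rhs => rw [mul_one, hd]
        simp [dotProduct, Finset.mul_sum, hw0, mul_assoc]
      obtain ⟨a1, ha1⟩ : ∃ a1, a1 = ∑ j, A 0 j * q' j := ⟨_, rfl⟩
      obtain ⟨z, hz⟩ := gcd_fam hB (fun j => A 0 j - a1 * w0 j)
      -- the kernel vector
      obtain ⟨k, hk⟩ : ∃ k : Fin n → R, k = fun j => z j - q' j * ∑ l, w0 l * z l := ⟨_, rfl⟩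
      have hk0 : ∑ j, w0 j * k j = 0 := by
        have e : ∑ j, w0 j * q' j = 1 := hw0q
        simp [hk, mul_sub, ← mul_assoc, ← Finset.sum_mul, e]
      have hkc : ∑ j, A 0 j * k j = ∑ j, (A 0 j - a1 * w0 j) * z j := by
        simp only [hk, mul_sub, sub_mul, Finset.sum_sub_distrib, ← mul_assoc, ← Finset.sum_mul,
          ← ha1]
        simp only [Finset.mul_sum, mul_assoc]
      rw [← hkc] at hz
      obtain ⟨c, hcc⟩ : ∃ c, c = ∑ j, A 0 j * k j := ⟨_, rfl⟩
      rw [← hcc] at hz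
      obtain ⟨t, s, X, Y, g, hg, g1, g2, g3⟩ := cond_hom hB hD hc d a1 c
      refine ⟨Fin.cons s (fun i => t * p' i), fun j => q' j * X + k j * Y, ?_⟩
      rw [hcons]
      have hwk : ∑ j, w j * k j = 0 := by
        simp only [hw0, mul_assoc, ← Finset.mul_sum, hk0, mul_zero]
      have hwq : ∑ j, w j * q' j = d := hd.symm
      have e : (fun j => s * A 0 j + t * w j) ⬝ᵥ (fun j => q' j * X + k j * Y) = g := by
        rw [← hg]
        simp only [dotProduct, mul_add, add_mul, Finset.sum_add_distrib]
        have f1 : ∑ j, s * A 0 j * (q' j * X) = s * a1 * X := by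
          rw [ha1]; simp only [Finset.mul_sum, Finset.sum_mul, mul_assoc]
        have f2 : ∑ j, t * w j * (q' j * X) = t * d * X := by
          rw [← hwq]; simp only [Finset.mul_sum, Finset.sum_mul, mul_assoc]
        have f3 : ∑ j, s * A 0 j * (k j * Y) = s * c * Y := by
          rw [hcc]; simp only [Finset.mul_sum, Finset.sum_mul, mul_assoc]
        have f4 : ∑ j, t * w j * (k j * Y) = t * (∑ j, w j * k j) * Y := by
          simp only [Finset.mul_sum, Finset.sum_mul, mul_assoc]
        rw [f1, f2, f3, f4, hwk]
        simp; abel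
      rw [e]
      intro i j
      refine Fin.cases ?_ (fun i => ?_) i
      · have : A 0 j = (A 0 j - a1 * w0 j) + a1 * w0 j := by abel
        rw [this]
        exact dvd_add (g3.trans (hz j)) (Dvd.dvd.mul_right g2 _)
      · exact g1.trans (h' i j)

lemma dvd_matrix (hD : IsDuoRing R) {m n k l : ℕ} {d : R} {A : Matrix (Fin m) (Fin n) R}
    (h : ∀ i j, d ∣ A i j) (P : Matrix (Fin k) (Fin m) R) (Q : Matrix (Fin n) (Fin l) R) :
    ∀ i j, d ∣ (P * A * Q) i j := by
  intro i j
  rw [Matrix.mul_apply]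
  refine Finset.dvd_sum fun a _ => Dvd.dvd.mul_right ?_ _
  rw [Matrix.mul_apply]
  exact Finset.dvd_sum fun b _ => dvd_mul_l hD (h _ _) _

lemma split_off (hB : IsBezoutRing R) (hD : IsDuoRing R)
    (hc : ∀ a b c : R, (∃ x y z : R, a * x + b * y + c * z = 1) →
        ∃ p q : R, ∃ x y : R, (p * a + q * b) * x + (q * c) * y = 1)
    (m n : ℕ) (A : Matrix (Fin (m + 1)) (Fin (n + 1)) R) :
    ∃ (P : Matrix (Fin (m + 1)) (Fin (m + 1)) R) (Q : Matrix (Fin (n + 1)) (Fin (n + 1)) R)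
      (d : R) (B : Matrix (Fin m) (Fin n) R), IsUnit P ∧ IsUnit Q ∧ P * A * Q = ext d B ∧
      ∀ i j, d ∣ B i j := by
  obtain ⟨p, q, h⟩ := represent hB hD hc _ _ A
  obtain ⟨d, hd⟩ : ∃ d, d = (p ᵥ* A) ⬝ᵥ q := ⟨_, rfl⟩
  rw [← hd] at h
  by_cases d0 : d = 0
  · refine ⟨1, 1, 0, 0, isUnit_one, isUnit_one, ?_, by simp⟩
    have hA : A = 0 := by
      ext i j
      have := h i j
      rw [d0, zero_dvd_iff] at this
      simpa using this
    rw [hA]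
    ext i j
    refine Fin.cases ?_ (fun i => ?_) i <;> refine Fin.cases ?_ (fun j => ?_) j <;> simp
  have hy : ∀ j, ∃ y, (p ᵥ* A) j = d * y := by
    intro j
    change d ∣ ∑ i, p i * A i j
    exact Finset.dvd_sum fun i _ => dvd_mul_l hD (h i j) _
  have hx : ∀ i, ∃ x, (A *ᵥ q) i = x * d := by
    intro i
    have : d ∣ ∑ j, A i j * q j := Finset.dvd_sum fun j _ => Dvd.dvd.mul_right (h i j) _
    obtain ⟨u, hu⟩ := this
    change ∃ x, ∑ j, A i j * q j = x * d
    rw [hu]; exact duo_left hD d u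
  choose y hy using hy
  choose x hx using hx
  have hpx : p ⬝ᵥ x = 1 := by
    apply mul_right_cancel₀ d0
    conv_rhs => rw [one_mul, hd, ← Matrix.dotProduct_mulVec]
    simp [dotProduct, hx, Finset.sum_mul, mul_assoc]
  have hyq : y ⬝ᵥ q = 1 := by
    apply mul_left_cancel₀ d0
    conv_rhs => rw [mul_one, hd]
    simp [dotProduct, hy, Finset.mul_sum, mul_assoc]
  obtain ⟨P, hP, hP1, hP2⟩ := complete hB _ p x hpx
  obtain ⟨_, ⟨Q, rfl⟩, hQ1, hQ2⟩ := complete hB _ y q hyq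
  have hQ3 : (↑Q⁻¹ : Matrix (Fin (n + 1)) (Fin (n + 1)) R) *ᵥ (Pi.single 0 1) = q := by
    rw [← hQ2, Matrix.mulVec_mulVec]; simp
  have hQ4 : y ᵥ* (↑Q⁻¹ : Matrix (Fin (n + 1)) (Fin (n + 1)) R) = Pi.single 0 1 := by
    rw [← hQ1, Matrix.vecMul_vecMul]; simp
  have hrow : (Pi.single 0 1) ᵥ* (P * A * (↑Q⁻¹ : Matrix (Fin (n + 1)) (Fin (n + 1)) R)) = Pi.single 0 d := by
    rw [← Matrix.vecMul_vecMul, ← Matrix.vecMul_vecMul, hP1]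
    have : p ᵥ* A = d • y := by ext j; simp [hy]
    rw [this, Matrix.smul_vecMul, hQ4]
    ext j; simp [Pi.single_apply]
  have hcol : (P * A * (↑Q⁻¹ : Matrix (Fin (n + 1)) (Fin (n + 1)) R)) *ᵥ (Pi.single 0 1) = Pi.single 0 d := by
    rw [← Matrix.mulVec_mulVec, ← Matrix.mulVec_mulVec, hQ3]
    have : A *ᵥ q = fun i => x i * d := by ext i; simp [hx]
    rw [this]
    ext i
    have h2 := congrFun hP2 i
    simp only [Matrix.mulVec, dotProduct] at h2 ⊢
    simp only [← mul_assoc, ← Finset.sum_mul, h2]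
    simp [Pi.single_apply]
  refine ⟨P, (↑Q⁻¹ : Matrix (Fin (n + 1)) (Fin (n + 1)) R), d, fun i j => (P * A * (↑Q⁻¹ : Matrix (Fin (n + 1)) (Fin (n + 1)) R)) i.succ j.succ, hP,
    Q⁻¹.isUnit, ?_, fun i j => dvd_matrix hD h _ _ _ _⟩
  ext i j
  refine Fin.cases ?_ (fun i => ?_) i
  · have := congrFun hrow j
    rw [Matrix.single_one_vecMul] at this
    rw [show (P * A * (↑Q⁻¹ : Matrix (Fin (n + 1)) (Fin (n + 1)) R)) 0 j = _ from this]
    refine Fin.cases ?_ (fun j => ?_) j <;> simp <;> rfl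
  · refine Fin.cases ?_ (fun j => ?_) j
    · have := congrFun hcol i.succ
      rw [Matrix.mulVec_single_one] at this
      rw [show (P * A * (↑Q⁻¹ : Matrix (Fin (n + 1)) (Fin (n + 1)) R)) i.succ 0 = _ from this]
      simp
      rfl
    · rfl

lemma backward (hB : IsBezoutRing R) (hD : IsDuoRing R)
    (hc : ∀ a b c : R, (∃ x y z : R, a * x + b * y + c * z = 1) →
        ∃ p q : R, ∃ x y : R, (p * a + q * b) * x + (q * c) * y = 1) :
    ElementaryDivisorRing R := by
  intro m
  induction m with
  | zero => exact fun n A => ⟨1, 1, isUnit_one, isUnit_one, fun i => i.elim0, fun i => i.elim0⟩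
  | succ m ih =>
    rintro (_ | n) A
    · exact ⟨1, 1, isUnit_one, isUnit_one, fun i j => j.elim0, fun i j => j.elim0⟩
    obtain ⟨P, Q, d, B, hP, hQ, hPQ, hdB⟩ := split_off hB hD hc m n A
    obtain ⟨P', Q', hP', hQ', h1, h2⟩ := ih n B
    have hD' : ∀ i j, d ∣ (P' * B * Q') i j := dvd_matrix hD hdB _ _
    refine ⟨ext 1 P' * P, Q * ext 1 Q', (ext_isUnit hP').mul hP, hQ.mul (ext_isUnit hQ'), ?_⟩
    have e : ext 1 P' * P * A * (Q * ext 1 Q') = ext d (P' * B * Q') := by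
      have : ext 1 P' * P * A * (Q * ext 1 Q') = ext 1 P' * (P * A * Q) * ext 1 Q' := by
        simp only [Matrix.mul_assoc]
      rw [this, hPQ, ext_mul, ext_mul, one_mul, mul_one]
    rw [e]
    generalize P' * B * Q' = D at *
    refine ⟨?_, ?_⟩
    · intro i j
      refine Fin.cases ?_ (fun i => ?_) i <;> refine Fin.cases ?_ (fun j => ?_) j
      · simp
      · simp
      · simp
      · intro hij
        exact h1 i j (by simpa using hij)
    · intro i j i' j' hij hij' hii x y
      obtain ⟨i', rfl⟩ : ∃ k : Fin m, i' = k.succ :=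
        Fin.exists_succ_eq.2 (by rintro rfl; simp at hii) |>.imp fun _ h => h.symm
      obtain ⟨j', rfl⟩ : ∃ k : Fin n, j' = k.succ :=
        Fin.exists_succ_eq.2 (by rintro rfl; simp at hij') |>.imp fun _ h => h.symm
      revert hij hii
      refine Fin.cases ?_ (fun i => ?_) i <;> refine Fin.cases ?_ (fun j => ?_) j
      · intro _ _
        have : d ∣ x * D i' j' * y := Dvd.dvd.mul_right (dvd_mul_l hD (hD' _ _) _) _
        obtain ⟨u, hu⟩ := this
        refine ⟨⟨u, hu⟩, ?_⟩
        obtain ⟨v, hv⟩ := duo_left hD d u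
        exact ⟨v, by simp only [ext_succ_succ, ext_zero_zero]; rw [hu, hv]⟩
      · intro h; simp at h
      · intro h; simp at h
      · intro h h'
        exact h2 i j i' j' (by simpa using h) (by simpa using hij') (by simpa using h') x y

lemma forward (hD : IsDuoRing R) (h : ElementaryDivisorRing R) (a b c : R)
    (habc : ∃ x y z : R, a * x + b * y + c * z = 1) :
    ∃ p q : R, ∃ x y : R, (p * a + q * b) * x + (q * c) * y = 1 := by
  obtain ⟨P, Q, ⟨P, rfl⟩, ⟨Q, rfl⟩, h1, h2⟩ := h 2 2 !![a, 0; b, c]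
  obtain ⟨D, hDe⟩ : ∃ D, D = (P : Matrix (Fin 2) (Fin 2) R) * !![a, 0; b, c] * (Q : Matrix (Fin 2) (Fin 2) R) := ⟨_, rfl⟩
  rw [← hDe] at h1 h2
  have hdv : ∀ i j, D 0 0 ∣ D i j := by
    simp only [Fin.forall_fin_two]
    refine ⟨⟨dvd_rfl, ?_⟩, ?_, ?_⟩
    · rw [h1 0 1 (by simp)]; exact dvd_zero _
    · rw [h1 1 0 (by simp)]; exact dvd_zero _
    · obtain ⟨⟨u, hu⟩, -⟩ := h2 0 0 1 1 rfl rfl rfl 1 1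
      exact ⟨u, by simpa using hu⟩
  have hA : (↑P⁻¹ : Matrix (Fin 2) (Fin 2) R) * D * (↑Q⁻¹ : Matrix (Fin 2) (Fin 2) R) = !![a, 0; b, c] := by
    rw [hDe]
    simp [mul_assoc]
  have hdA := dvd_matrix hD hdv (↑P⁻¹ : Matrix (Fin 2) (Fin 2) R) (↑Q⁻¹ : Matrix (Fin 2) (Fin 2) R)
  rw [hA] at hdA
  have ha : D 0 0 ∣ a := hdA 0 0
  have hb : D 0 0 ∣ b := hdA 1 0
  have hc : D 0 0 ∣ c := hdA 1 1
  obtain ⟨x, y, z, hxyz⟩ := habc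
  have hone : D 0 0 ∣ 1 := by
    rw [← hxyz]
    exact dvd_add (dvd_add (ha.mul_right _) (hb.mul_right _)) (hc.mul_right _)
  obtain ⟨u, hu⟩ := hone
  refine ⟨(P : Matrix (Fin 2) (Fin 2) R) 0 0, (P : Matrix (Fin 2) (Fin 2) R) 0 1, (Q : Matrix (Fin 2) (Fin 2) R) 0 0 * u,
    (Q : Matrix (Fin 2) (Fin 2) R) 1 0 * u, ?_⟩
  rw [hu, hDe]
  simp [Matrix.mul_apply, Fin.sum_univ_two, add_mul, mul_assoc]

end

end BezoutDuo

/-- A Bézout duo-domain `R` is an elementary divisor ring iff whenever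
`aR + bR + cR = R` there are `p, q` with `(pa + qb)R + qcR = R`. -/
theorem stmt4 (R : Type*) [Ring R] [IsDomain R]
    (hB : IsBezoutRing R) (hD : IsDuoRing R) :
    ElementaryDivisorRing R ↔
      ∀ a b c : R, (∃ x y z : R, a * x + b * y + c * z = 1) →
        ∃ p q : R, ∃ x y : R, (p * a + q * b) * x + (q * c) * y = 1 := by
  exact ⟨fun h a b c => BezoutDuo.forward hD h a b c, BezoutDuo.backward hB hD⟩
end

section
/- Let R be a Bézout duo-domain. Then R is an elementary divisor ring if and only if for all a, b, c ∈ R with Ra + Rb + Rc = R there exist r, s, t ∈ R such that rt ∈ sR and ra + sb + tc = 1. -/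
namespace Stmt5

open Finset

variable {R : Type*} [Ring R]

/-- Right Bezout condition, elementwise. -/
def RB (R : Type*) [Ring R] : Prop :=
  ∀ a b : R, ∃ d x y : R, d = a * x + b * y ∧ d ∣ a ∧ d ∣ b

theorem rb_of (hB : IsBezoutRing R) : RB R := by
  intro a b
  obtain ⟨d, hd⟩ := hB.2 (Submodule.span Rᵐᵒᵖ {a, b})
    (Submodule.fg_span (Set.toFinite _))
  have h1 : d ∈ Submodule.span Rᵐᵒᵖ {a, b} := by
    rw [hd]; exact Submodule.mem_span_singleton_self d
  obtain ⟨x, y, hxy⟩ := Submodule.mem_span_pair.1 h1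
  have ha : a ∈ Submodule.span Rᵐᵒᵖ {d} := by
    rw [← hd]; exact Submodule.subset_span (by simp)
  have hb : b ∈ Submodule.span Rᵐᵒᵖ {d} := by
    rw [← hd]; exact Submodule.subset_span (by simp)
  obtain ⟨u, hu⟩ := Submodule.mem_span_singleton.1 ha
  obtain ⟨v, hv⟩ := Submodule.mem_span_singleton.1 hb
  exact ⟨d, x.unop, y.unop, hxy.symm, ⟨u.unop, hu.symm⟩, ⟨v.unop, hv.symm⟩⟩

theorem rb_op_of (hB : IsBezoutRing R) : RB Rᵐᵒᵖ := by
  intro a b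
  obtain ⟨d, hd⟩ := hB.1 (Ideal.span {a.unop, b.unop}) (Submodule.fg_span (Set.toFinite _))
  have h1 : d ∈ Ideal.span {a.unop, b.unop} := by
    rw [hd]; exact Ideal.mem_span_singleton_self d
  obtain ⟨x, y, hxy⟩ := Submodule.mem_span_pair.1 h1
  have ha : a.unop ∈ Ideal.span {d} := by
    rw [← hd]; exact Submodule.subset_span (by simp)
  have hb : b.unop ∈ Ideal.span {d} := by
    rw [← hd]; exact Submodule.subset_span (by simp)
  obtain ⟨u, hu⟩ := Submodule.mem_span_singleton.1 ha
  obtain ⟨v, hv⟩ := Submodule.mem_span_singleton.1 hb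
  refine ⟨.op d, .op x, .op y, ?_, ⟨.op u, ?_⟩, ⟨.op v, ?_⟩⟩ <;>
    apply MulOpposite.unop_injective <;> simp_all

theorem duo_l (hD : IsDuoRing R) (a r : R) : ∃ s, a * r = s * a := by
  have := hD.1 (Ideal.span {a}) a (Ideal.mem_span_singleton_self a) r
  obtain ⟨u, hu⟩ := Submodule.mem_span_singleton.1 this
  exact ⟨u, hu.symm⟩

theorem duo_r (hD : IsDuoRing R) (a r : R) : ∃ s, r * a = a * s := by
  have := hD.2 (Submodule.span Rᵐᵒᵖ {a}) a (Submodule.mem_span_singleton_self a) r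
  obtain ⟨u, hu⟩ := Submodule.mem_span_singleton.1 this
  exact ⟨u.unop, hu.symm⟩

theorem duo_dvd (hD : IsDuoRing R) {a b : R} (r : R) (h : a ∣ b) : a ∣ r * b := by
  obtain ⟨c, rfl⟩ := h
  obtain ⟨s, hs⟩ := duo_r hD a r
  exact ⟨s * c, by rw [← mul_assoc, hs, mul_assoc]⟩

theorem bez_col (hB : IsBezoutRing R) (hD : IsDuoRing R) {m : ℕ} (c : Fin m → R) :
    ∃ p : Fin m → R, ∀ i, (∑ i, p i * c i) ∣ c i := by
  obtain ⟨d, hd⟩ := hB.1 (Ideal.span (Set.range c))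
    (Submodule.fg_span (Set.finite_range c))
  have h1 : d ∈ Ideal.span (Set.range c) := by
    rw [hd]; exact Ideal.mem_span_singleton_self d
  obtain ⟨p, hp⟩ := (Submodule.mem_span_range_iff_exists_fun R).1 h1
  refine ⟨p, fun i => ?_⟩
  have hc : c i ∈ Ideal.span {d} := by
    rw [← hd]; exact Submodule.subset_span ⟨i, rfl⟩
  obtain ⟨u, hu⟩ := Submodule.mem_span_singleton.1 hc
  simp only [smul_eq_mul] at hp hu
  rw [hp, ← hu]
  exact duo_dvd hD _ dvd_rfl

/-! ### Bilinear form -/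

def Bf {m n : ℕ} (A : Matrix (Fin m) (Fin n) R) (p : Fin m → R) (q : Fin n → R) : R :=
  ∑ i, ∑ j, p i * A i j * q j

theorem Bf_left {m n : ℕ} (A : Matrix (Fin m) (Fin n) R) (p p' : Fin m → R) (q : Fin n → R)
    (x y : R) : Bf A (fun i => x * p i + y * p' i) q = x * Bf A p q + y * Bf A p' q := by
  simp only [Bf, Finset.mul_sum, ← Finset.sum_add_distrib]
  refine Finset.sum_congr rfl fun i _ => Finset.sum_congr rfl fun j _ => ?_
  noncomm_ring

theorem Bf_right {m n : ℕ} (A : Matrix (Fin m) (Fin n) R) (p : Fin m → R) (q q' : Fin n → R)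
    (x y : R) : Bf A p (fun i => q i * x + q' i * y) = Bf A p q * x + Bf A p q' * y := by
  simp only [Bf, Finset.sum_mul, ← Finset.sum_add_distrib]
  refine Finset.sum_congr rfl fun i _ => Finset.sum_congr rfl fun j _ => ?_
  noncomm_ring

/-- The condition of the theorem. -/
def Cond (R : Type*) [Ring R] : Prop :=
  ∀ a b c : R, (∃ x y z : R, x * a + y * b + z * c = 1) →
        ∃ r s t : R, (∃ u : R, r * t = s * u) ∧ r * a + s * b + t * c = 1

theorem cond_kap [IsDomain R] (hB : IsBezoutRing R) (hD : IsDuoRing R) (hC : Cond R)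
    (a b c : R) (h : ∃ x y z : R, x * a + y * b + z * c = 1) :
    ∃ p q x y : R, x * (p * a + q * b) + y * (q * c) = 1 := by
  obtain ⟨r, s, t, ⟨u, hu⟩, h1⟩ := hC a b c h
  obtain ⟨d, α, β, hd, ⟨p, hp⟩, ⟨q, hq⟩⟩ := rb_of hB r s
  by_cases h0 : d = 0
  · subst h0
    refine ⟨0, 1, 0, t, ?_⟩
    rw [hp, hq] at h1; simpa using h1
  · have e1 : p * α + q * β = 1 := by
      apply mul_left_cancel₀ h0
      rw [mul_add, ← mul_assoc, ← mul_assoc, ← hp, ← hq, ← hd, mul_one]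
    have e2 : p * t = q * u := by
      apply mul_left_cancel₀ h0
      rw [← mul_assoc, ← mul_assoc, ← hp, ← hq, hu]
    obtain ⟨α', hα⟩ := duo_l hD p α
    obtain ⟨β', hβ⟩ := duo_l hD q β
    have e3 : q ∣ t := by
      have : t = α' * (q * u) + β' * (q * t) := by
        rw [← e2, ← mul_assoc, ← mul_assoc, ← hα, ← hβ, ← add_mul, e1, one_mul]
      rw [this]
      exact dvd_add (duo_dvd hD _ (dvd_mul_right _ _)) (duo_dvd hD _ (dvd_mul_right _ _))
    obtain ⟨y, hy⟩ := e3
    obtain ⟨y', hy'⟩ := duo_l hD q y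
    refine ⟨p, q, d, y', ?_⟩
    rw [← h1, ← mul_assoc y', ← hy', ← hy, hp, hq]
    noncomm_ring

theorem tri [IsDomain R] (hB : IsBezoutRing R) (hD : IsDuoRing R) (hC : Cond R)
    (a b c : R) : ∃ p q x y : R,
      ((p * a + q * b) * x + (q * c) * y) ∣ a ∧
      ((p * a + q * b) * x + (q * c) * y) ∣ b ∧
      ((p * a + q * b) * x + (q * c) * y) ∣ c := by
  -- right gcd of three
  obtain ⟨d, x, y, hd, ha, hb⟩ := rb_of hB a b
  obtain ⟨e, x', y', he, hed, hec⟩ := rb_of hB d c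
  have hea := hed.trans ha
  have heb := hed.trans hb
  by_cases h0 : e = 0
  · subst h0
    rw [zero_dvd_iff] at hea heb hec
    subst hea heb hec
    exact ⟨0, 0, 0, 0, by simp⟩
  obtain ⟨a1, rfl⟩ := hea
  obtain ⟨b1, rfl⟩ := heb
  obtain ⟨c1, rfl⟩ := hec
  have e1 : a1 * (x * x') + b1 * (y * x') + c1 * y' = 1 := by
    apply mul_left_cancel₀ h0
    rw [mul_one]
    conv_rhs => rw [he, hd]
    noncomm_ring
  obtain ⟨a2, ha2⟩ := duo_l hD e a1
  obtain ⟨b2, hb2⟩ := duo_l hD e b1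
  obtain ⟨c2, hc2⟩ := duo_l hD e c1
  obtain ⟨X, hX⟩ := duo_l hD (e * a1) (x * x')
  obtain ⟨Y, hY⟩ := duo_l hD (e * b1) (y * x')
  obtain ⟨Z, hZ⟩ := duo_l hD (e * c1) y'
  have e2 : X * a2 + Y * b2 + Z * c2 = 1 := by
    apply mul_right_cancel₀ h0
    rw [add_mul, add_mul, mul_assoc, mul_assoc, mul_assoc, ← ha2, ← hb2, ← hc2, ← hX, ← hY, ← hZ,
      mul_assoc, mul_assoc, mul_assoc, ← mul_add, ← mul_add, e1, one_mul, mul_one]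
  obtain ⟨p, q, s, t, hk⟩ := cond_kap hB hD hC a2 b2 c2 ⟨_, _, _, e2⟩
  obtain ⟨s', hs'⟩ := duo_r hD (p * (e * a1) + q * (e * b1)) s
  obtain ⟨t', ht'⟩ := duo_r hD (q * (e * c1)) t
  have key : (p * (e * a1) + q * (e * b1)) * s' + (q * (e * c1)) * t' = e := by
    rw [← hs', ← ht', ha2, hb2, hc2]
    conv_rhs => rw [← one_mul e, ← hk]
    noncomm_ring
  refine ⟨p, q, s', t', ?_⟩
  rw [key]
  exact ⟨dvd_mul_right _ _, dvd_mul_right _ _, dvd_mul_right _ _⟩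

theorem two [IsDomain R] (hB : IsBezoutRing R) (hD : IsDuoRing R) (hC : Cond R)
    {m n : ℕ} (A : Matrix (Fin m) (Fin n) R) (p1 p2 : Fin m → R) (q1 q2 : Fin n → R) :
    ∃ p q, Bf A p q ∣ Bf A p1 q1 ∧ Bf A p q ∣ Bf A p2 q2 := by
  obtain ⟨g, x, y, hg, ⟨a', ha⟩, ⟨e', he⟩⟩ := rb_of hB (Bf A p1 q1) (Bf A p1 q2)
  set q' : Fin n → R := fun i => q1 i * x + q2 i * y with hq'
  have hg' : Bf A p1 q' = g := by rw [hq', Bf_right, hg]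
  set k1 : Fin n → R := fun i => q1 i * 1 + q' i * (-a') with hk1
  set k2 : Fin n → R := fun i => q2 i * 1 + q' i * (-e') with hk2
  have z1 : Bf A p1 k1 = 0 := by rw [hk1, Bf_right, hg', ha]; noncomm_ring
  have z2 : Bf A p1 k2 = 0 := by rw [hk2, Bf_right, hg', he]; noncomm_ring
  obtain ⟨h, x2, y2, hh, hh1, hh2⟩ := rb_of hB (Bf A p2 k1) (Bf A p2 k2)
  set k : Fin n → R := fun i => k1 i * x2 + k2 i * y2 with hk
  have z : Bf A p1 k = 0 := by rw [hk, Bf_right, z1, z2]; simp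
  have hk' : Bf A p2 k = h := by rw [hk, Bf_right, hh]
  obtain ⟨p, q, s, t, d1, d2, d3⟩ := tri hB hD hC g (Bf A p2 q') h
  refine ⟨fun i => p * p1 i + q * p2 i, fun i => q' i * s + k i * t, ?_⟩
  have key : Bf A (fun i => p * p1 i + q * p2 i) (fun i => q' i * s + k i * t)
      = (p * g + q * Bf A p2 q') * s + (q * h) * t := by
    rw [Bf_right, Bf_left, Bf_left, hg', z, hk']; simp
  rw [key]
  refine ⟨ha ▸ d1.mul_right _, ?_⟩
  have : Bf A p2 q2 = Bf A p2 k2 + Bf A p2 q' * e' := by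
    rw [hk2, Bf_right]; noncomm_ring
  rw [this]
  exact dvd_add (d3.trans hh2) (d2.mul_right _)

theorem content [IsDomain R] (hB : IsBezoutRing R) (hD : IsDuoRing R) (hC : Cond R)
    {m : ℕ} : ∀ {n : ℕ} (A : Matrix (Fin m) (Fin n) R),
    ∃ p q, ∀ i j, Bf A p q ∣ A i j := by
  intro n
  induction n with
  | zero => intro A; exact ⟨0, 0, fun i j => j.elim0⟩
  | succ n ih =>
    intro A
    obtain ⟨p, q, h⟩ := ih (Matrix.of fun i j => A i j.succ)
    obtain ⟨p', h'⟩ := bez_col hB hD (fun i => A i 0)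
    obtain ⟨P, Q, h1, h2⟩ := two hB hD hC A p p' (Fin.cons 0 q) (Pi.single 0 1)
    have e1 : Bf A p (Fin.cons 0 q : Fin (n+1) → R) = Bf (Matrix.of fun i j => A i j.succ) p q := by
      simp [Bf, Fin.sum_univ_succ]
    have e2 : Bf A p' (Pi.single 0 1) = ∑ i, p' i * A i 0 := by
      simp [Bf, Fin.sum_univ_succ]
    refine ⟨P, Q, fun i j => ?_⟩
    refine Fin.cases ?_ (fun j => ?_) j
    · exact (e2 ▸ h2).trans (h' i)
    · exact (e1 ▸ h1).trans (h i j)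

/-! ### Block matrices and completion -/

def G {m n : ℕ} (c : R) (u : Fin n → R) (l : Fin m → R) (M : Matrix (Fin m) (Fin n) R) :
    Matrix (Fin (m+1)) (Fin (n+1)) R :=
  Matrix.of (Fin.cons (Fin.cons c u) fun i => Fin.cons (l i) (M i))

theorem G_mul {m n k : ℕ} (c c' : R) (u : Fin n → R) (u' : Fin k → R) (l : Fin m → R)
    (l' : Fin n → R) (M : Matrix (Fin m) (Fin n) R) (M' : Matrix (Fin n) (Fin k) R) :
    G c u l M * G c' u' l' M' =
      G (c * c' + ∑ j, u j * l' j) (fun j => c * u' j + ∑ i, u i * M' i j)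
        (fun i => l i * c' + ∑ j, M i j * l' j)
        (Matrix.of fun i j => l i * u' j + ∑ k, M i k * M' k j) := by
  ext i j
  refine Fin.cases ?_ (fun i => ?_) i <;> refine Fin.cases ?_ (fun j => ?_) j <;>
    simp [G, Matrix.mul_apply, Fin.sum_univ_succ]

theorem G_one {m : ℕ} : G (1 : R) 0 0 (1 : Matrix (Fin m) (Fin m) R) = 1 := by
  ext i j
  refine Fin.cases ?_ (fun i => ?_) i <;> refine Fin.cases ?_ (fun j => ?_) j <;>
    simp [G, Matrix.one_apply, Fin.succ_ne_zero, (Fin.succ_ne_zero _).symm]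

theorem G_diag_mul {m n k : ℕ} (c c' : R)
    (M : Matrix (Fin m) (Fin n) R) (M' : Matrix (Fin n) (Fin k) R) :
    G c 0 0 M * G c' 0 0 M' = G (c * c') 0 0 (M * M') := by
  rw [G_mul]
  congr 1 <;> (try ext) <;> simp [Matrix.mul_apply]

theorem isUnit_of {m : ℕ} {P Q : Matrix (Fin m) (Fin m) R} (h : P * Q = 1) (h' : Q * P = 1) :
    IsUnit P := ⟨⟨P, Q, h, h'⟩, rfl⟩

theorem G_unit {m : ℕ} {M : Matrix (Fin m) (Fin m) R} (h : IsUnit M) :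
    IsUnit (G (1 : R) 0 0 M) := by
  obtain ⟨⟨M, N, h1, h2⟩, rfl⟩ := h
  exact isUnit_of (Q := G 1 0 0 N) (by simp [G_diag_mul, h1, G_one])
    (by simp [G_diag_mul, h2, G_one])

theorem L_unit {m : ℕ} (l : Fin m → R) : IsUnit (G (1 : R) 0 l (1 : Matrix (Fin m) (Fin m) R)) := by
  refine isUnit_of (Q := G 1 0 (-l) 1) ?_ ?_ <;>
  · rw [G_mul, ← G_one]
    congr 1 <;> (try ext) <;> simp [Matrix.one_apply]

theorem U_unit {m : ℕ} (u : Fin m → R) : IsUnit (G (1 : R) u 0 (1 : Matrix (Fin m) (Fin m) R)) := by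
  refine isUnit_of (Q := G 1 (-u) 0 1) ?_ ?_ <;>
  · rw [G_mul, ← G_one]
    congr 1 <;> (try ext) <;> simp [Matrix.one_apply]

/-- 2x2 block embedded in the top-left corner -/
def F (n : ℕ) (x y z w : R) : Matrix (Fin (n+2)) (Fin (n+2)) R :=
  G x (Fin.cons y 0) (Fin.cons z 0) (G w 0 0 1)

theorem F_mul (n : ℕ) (x y z w x' y' z' w' : R) :
    F n x y z w * F n x' y' z' w' =
      F n (x * x' + y * z') (x * y' + y * w') (z * x' + w * z') (z * y' + w * w') := by
  ext i j
  refine Fin.cases ?_ (fun i => Fin.cases ?_ (fun i => ?_) i) i <;>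
  refine Fin.cases ?_ (fun j => Fin.cases ?_ (fun j => ?_) j) j <;>
    simp [F, G, Matrix.mul_apply, Fin.sum_univ_succ, Matrix.one_apply]

theorem F_one (n : ℕ) : F n (1 : R) 0 0 1 = 1 := by
  unfold F
  have h : (Fin.cons 0 0 : Fin (n+1) → R) = 0 := by
    ext i; refine Fin.cases ?_ (fun i => ?_) i <;> simp
  rw [h, G_one, G_one]

theorem two_complete [IsDomain R] (hR : RB R) (a b : R) :
    ∃ d x y z w x' y' z' w' : R, a = d * x ∧ b = d * y ∧
      x * x' + y * z' = 1 ∧ x * y' + y * w' = 0 ∧ z * x' + w * z' = 0 ∧ z * y' + w * w' = 1 ∧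
      x' * x + y' * z = 1 ∧ x' * y + y' * w = 0 ∧ z' * x + w' * z = 0 ∧ z' * y + w' * w = 1 := by
  by_cases hb : b = 0
  · exact ⟨a, 1, 0, 0, 1, 1, 0, 0, 1, by simp [hb]⟩
  obtain ⟨d, α, β, hd, ⟨x, hx⟩, ⟨y, hy⟩⟩ := hR a b
  have hd0 : d ≠ 0 := by rintro rfl; simp at hy; exact hb hy
  have hy0 : y ≠ 0 := by rintro rfl; simp at hy; exact hb hy
  have e1 : x * α + y * β = 1 := by
    apply mul_left_cancel₀ hd0
    rw [mul_add, ← mul_assoc, ← mul_assoc, ← hx, ← hy, ← hd, mul_one]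
  obtain ⟨y', s, t, hy', ⟨z, hz⟩, ⟨w, hw⟩⟩ := hR (1 - α * x) (-(α * y))
  obtain ⟨w', hw'⟩ : ∃ w', w' = -(β * x) * s + (1 - β * y) * t := ⟨_, rfl⟩
  have k : x * y' + y * w' = 0 := by
    have : x * y' + y * w' = (x - (x * α + y * β) * x) * s + (y - (x * α + y * β) * y) * t := by
      rw [hy', hw']; noncomm_ring
    rw [this, e1]; simp
  have c3 : β * x + w' * z = 0 := by
    apply mul_left_cancel₀ hy0
    have : y * (β * x + w' * z) = (x * α + y * β) * x - x * (α * x + y' * z)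
      + (x * y' + y * w') * z := by noncomm_ring
    rw [this, e1, k, ← hz]; simp
  have c4 : β * y + w' * w = 1 := by
    apply mul_left_cancel₀ hy0
    have : y * (β * y + w' * w) = (x * α + y * β) * y - x * (α * y + y' * w)
      + (x * y' + y * w') * w := by noncomm_ring
    rw [this, e1, k, ← hw]; simp
  have hy'0 : y' ≠ 0 := by
    intro h
    rw [h, zero_mul] at hz hw
    have h1 : α * y = 0 := by simpa using hw
    have h2 : α = 0 := (mul_eq_zero.1 h1).resolve_right hy0
    simp [h2] at hz
  refine ⟨d, x, y, z, w, α, y', β, w', hx, hy, e1, k, ?_, ?_, ?_, ?_, c3, c4⟩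
  · apply mul_left_cancel₀ hy'0
    have : y' * (z * α + w * β) = (y' * z) * α + (y' * w) * β := by noncomm_ring
    rw [this, ← hz, ← hw]
    have : (1 - α * x) * α + -(α * y) * β = α - α * (x * α + y * β) := by noncomm_ring
    rw [this, e1]; simp
  · apply mul_left_cancel₀ hy'0
    have : y' * (z * y' + w * w') = (y' * z) * y' + (y' * w) * w' := by noncomm_ring
    rw [this, ← hz, ← hw]
    have : (1 - α * x) * y' + -(α * y) * w' = y' - α * (x * y' + y * w') := by noncomm_ring
    rw [this, k]; simp
  · rw [← hz]; simp
  · rw [← hw]; simp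

theorem row_complete [IsDomain R] (hR : RB R) : ∀ (n : ℕ) (p : Fin (n+1) → R),
    ∃ (d : R) (Q : Matrix (Fin (n+1)) (Fin (n+1)) R), IsUnit Q ∧ ∀ i, p i = d * Q 0 i := by
  intro n
  induction n with
  | zero =>
    intro p
    refine ⟨p 0, 1, isUnit_one, fun i => ?_⟩
    have : i = 0 := by omega
    rw [this]; simp
  | succ n ih =>
    intro p
    obtain ⟨e, Q, hQ, h⟩ := ih (fun i => p i.succ)
    obtain ⟨d, x, y, z, w, x', y', z', w', ha, hb, h1, h2, h3, h4, h5, h6, h7, h8⟩ :=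
      two_complete hR (p 0) e
    refine ⟨d, F n x y z w * G 1 0 0 Q, IsUnit.mul ?_ (G_unit hQ), fun i => ?_⟩
    · refine isUnit_of (Q := F n x' y' z' w') ?_ ?_
      · rw [F_mul, h1, h2, h3, h4, F_one]
      · rw [F_mul, h5, h6, h7, h8, F_one]
    · refine Fin.cases ?_ (fun i => ?_) i
      · simp [F, G, Matrix.mul_apply, Fin.sum_univ_succ, ha]
      · rw [h, hb]
        simp [F, G, Matrix.mul_apply, Fin.sum_univ_succ, mul_assoc]

theorem col_complete [IsDomain R] (hR : RB Rᵐᵒᵖ) (n : ℕ) (p : Fin (n+1) → R) :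
    ∃ (d : R) (Q : Matrix (Fin (n+1)) (Fin (n+1)) R), IsUnit Q ∧ ∀ i, p i = Q i 0 * d := by
  obtain ⟨d, Q, ⟨⟨Q, Q', h1, h2⟩, rfl⟩, h⟩ := row_complete hR n (fun i => .op (p i))
  refine ⟨d.unop, Matrix.of fun i j => (Q j i).unop,
    isUnit_of (Q := Matrix.of fun i j => (Q' j i).unop) ?_ ?_, fun i => ?_⟩
  · ext i j
    have := congrArg MulOpposite.unop (congrFun (congrFun h2 j) i)
    simp only [Matrix.mul_apply, Finset.unop_sum, MulOpposite.unop_mul] at this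
    simp only [Matrix.mul_apply, Matrix.of_apply]
    rw [this]
    simp [Matrix.one_apply, eq_comm, apply_ite MulOpposite.unop]
  · ext i j
    have := congrArg MulOpposite.unop (congrFun (congrFun h1 j) i)
    simp only [Matrix.mul_apply, Finset.unop_sum, MulOpposite.unop_mul] at this
    simp only [Matrix.mul_apply, Matrix.of_apply]
    rw [this]
    simp [Matrix.one_apply, eq_comm, apply_ite MulOpposite.unop]
  · simpa using congrArg MulOpposite.unop (h i)

theorem dvd_mul_mat (hD : IsDuoRing R) {m n : ℕ} {c : R} {A : Matrix (Fin m) (Fin n) R}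
    (h : ∀ i j, c ∣ A i j) (P : Matrix (Fin m) (Fin m) R) (Q : Matrix (Fin n) (Fin n) R) :
    ∀ i j, c ∣ (P * A * Q) i j := by
  intro i j
  simp only [Matrix.mul_apply]
  exact Finset.dvd_sum fun k _ => Dvd.dvd.mul_right (Finset.dvd_sum fun l _ =>
    duo_dvd hD _ (h _ _)) _

/-- first step of reduction -/
theorem step [IsDomain R] (hB : IsBezoutRing R) (hD : IsDuoRing R) (hC : Cond R)
    {m n : ℕ} (A : Matrix (Fin (m+1)) (Fin (n+1)) R) :
    ∃ (P : Matrix (Fin (m+1)) (Fin (m+1)) R) (Q : Matrix (Fin (n+1)) (Fin (n+1)) R)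
      (c : R) (B : Matrix (Fin m) (Fin n) R), IsUnit P ∧ IsUnit Q ∧ P * A * Q = G c 0 0 B ∧ ∀ i j, c ∣ B i j := by
  obtain ⟨p, q, h⟩ := content hB hD hC A
  obtain ⟨d, P, hP, hp⟩ := row_complete (rb_of hB) m p
  obtain ⟨e, Q, hQ, hq⟩ := col_complete (rb_op_of hB) n q
  have h1 : Bf A p q = d * (P * A * Q) 0 0 * e := by
    simp only [Bf, Matrix.mul_apply, Finset.mul_sum, Finset.sum_mul, hp, hq]
    rw [Finset.sum_comm]
    refine Finset.sum_congr rfl fun i _ => Finset.sum_congr rfl fun j _ => ?_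
    noncomm_ring
  have h2 : ∀ i j, (P * A * Q) 0 0 ∣ (P * A * Q) i j := by
    refine dvd_mul_mat hD (fun i j => dvd_trans ?_ (h i j)) P Q
    rw [h1]
    exact (duo_dvd hD _ dvd_rfl).mul_right _
  generalize hCC : P * A * Q = C at h2
  choose u hu using fun j : Fin n => h2 0 j.succ
  choose l' hl' using fun i : Fin m => h2 i.succ 0
  choose l hl using fun i : Fin m => duo_l hD (C 0 0) (l' i)
  have hCG : C = G (C 0 0) (fun j => C 0 0 * u j) (fun i => l i * C 0 0)
      (Matrix.of fun i j => C i.succ j.succ) := by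
    ext i j
    refine Fin.cases ?_ (fun i => ?_) i <;> refine Fin.cases ?_ (fun j => ?_) j <;>
      simp [G, ← hu, ← hl, ← hl']
  refine ⟨G 1 0 (-l) 1 * P, Q * G 1 (-u) 0 1, C 0 0,
    Matrix.of fun i j => C i.succ j.succ - l i * C 0 0 * u j, (L_unit _).mul hP, hQ.mul (U_unit _), ?_, ?_⟩
  · have : ∀ (X : Matrix (Fin (m+1)) (Fin (m+1)) R) (Y : Matrix (Fin (n+1)) (Fin (n+1)) R),
        X * P * A * (Q * Y) = X * (P * A * Q) * Y := by
      intro X Y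
      simp only [Matrix.mul_assoc]
    rw [this, hCC]
    conv_lhs => rw [hCG]
    rw [G_mul, G_mul]
    congr 1 <;> (try ext) <;> simp [Matrix.one_apply, mul_assoc, sub_eq_add_neg, add_comm]
  · intro i j
    exact dvd_sub (h2 _ _) ((duo_dvd hD _ dvd_rfl).mul_right _)

theorem reduce [IsDomain R] (hB : IsBezoutRing R) (hD : IsDuoRing R) (hC : Cond R) :
    ∀ (m n : ℕ) (A : Matrix (Fin m) (Fin n) R), ∃ (P : Matrix (Fin m) (Fin m) R)
      (Q : Matrix (Fin n) (Fin n) R), IsUnit P ∧ IsUnit Q ∧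
      (∀ (i : Fin m) (j : Fin n), (i : ℕ) ≠ (j : ℕ) → (P * A * Q) i j = 0) ∧
      (∀ (i : Fin m) (j : Fin n) (i' : Fin m) (j' : Fin n),
        (i : ℕ) = (j : ℕ) → (i' : ℕ) = (j' : ℕ) → (i' : ℕ) = (i : ℕ) + 1 →
        (P * A * Q) i j ∣ (P * A * Q) i' j') := by
  intro m
  induction m with
  | zero => intro n A; exact ⟨1, 1, isUnit_one, isUnit_one, fun i => i.elim0, fun i => i.elim0⟩
  | succ m ih =>
    intro n A
    cases n with
    | zero => exact ⟨1, 1, isUnit_one, isUnit_one, fun i j => j.elim0, fun i j => j.elim0⟩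
    | succ n =>
      obtain ⟨P, Q, c, B, hP, hQ, hPQ, hc⟩ := step hB hD hC A
      obtain ⟨P', Q', hP', hQ', h1, h2⟩ := ih n B
      refine ⟨G 1 0 0 P' * P, Q * G 1 0 0 Q', (G_unit hP').mul hP, hQ.mul (G_unit hQ'), ?_⟩
      have hc' := dvd_mul_mat hD hc P' Q'
      have key : G 1 0 0 P' * P * A * (Q * G 1 0 0 Q') = G c 0 0 (P' * B * Q') := by
        have : G 1 0 0 P' * P * A * (Q * G 1 0 0 Q') = G 1 0 0 P' * (P * A * Q) * G 1 0 0 Q' := by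
          simp only [Matrix.mul_assoc]
        rw [this, hPQ, G_diag_mul, G_diag_mul]; simp
      rw [key]
      generalize P' * B * Q' = D at h1 h2 hc'
      constructor
      · intro i j
        refine Fin.cases ?_ (fun i => ?_) i <;> refine Fin.cases ?_ (fun j => ?_) j
        · simp
        · intro _; simp [G]
        · intro _; simp [G]
        · intro h; simpa [G] using h1 i j (by simpa using h)
      · intro i j i' j' hij hij' hii
        obtain ⟨i', rfl⟩ : ∃ k : Fin m, i' = k.succ :=
          Fin.exists_succ_eq.2 (by rintro rfl; simp at hii) |>.imp fun _ h => h.symm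
        obtain ⟨j', rfl⟩ : ∃ k : Fin n, j' = k.succ :=
          Fin.exists_succ_eq.2 (by rintro rfl; simp at hij') |>.imp fun _ h => h.symm
        revert hij hii
        refine Fin.cases ?_ (fun i => ?_) i <;> refine Fin.cases ?_ (fun j => ?_) j
        · intro _ _; simpa [G] using hc' i' j'
        · intro h; simp at h
        · intro h; simp at h
        · intro h h'
          simpa [G] using h2 i j i' j' (by simpa using h) (by simpa using hij') (by simpa using h')

theorem edr_of_cond [IsDomain R] (hB : IsBezoutRing R) (hD : IsDuoRing R) (hC : Cond R) :
    ElementaryDivisorRing R := by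
  intro m n A
  obtain ⟨P, Q, hP, hQ, h1, h2⟩ := reduce hB hD hC m n A
  refine ⟨P, Q, hP, hQ, h1, fun i j i' j' a b c x y => ?_⟩
  obtain ⟨u, hu⟩ := (duo_dvd hD x (h2 i j i' j' a b c)).mul_right y
  obtain ⟨v, hv⟩ := duo_l hD ((P * A * Q) i j) u
  exact ⟨⟨u, hu⟩, ⟨v, hu.trans hv⟩⟩

theorem cond_of_edr [IsDomain R] (hD : IsDuoRing R) (hE : ElementaryDivisorRing R) : Cond R := by
  rintro a b c ⟨x0, y0, z0, hxyz⟩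
  obtain ⟨P, Q, hP, hQ, h1, h2⟩ := hE 2 2 !![a, 0; b, c]
  obtain ⟨⟨P, P', p1, p2⟩, rfl⟩ := hP
  obtain ⟨⟨Q, Q', q1, q2⟩, rfl⟩ := hQ
  simp only at h1 h2
  have hA : P' * (P * !![a, 0; b, c] * Q) * Q' = !![a, 0; b, c] := by
    have : P' * (P * !![a, 0; b, c] * Q) * Q' = (P' * P) * !![a, 0; b, c] * (Q * Q') := by
      simp only [Matrix.mul_assoc]
    rw [this, p2, q1]; simp
  have hdv : ∀ i j, (P * !![a, 0; b, c] * Q) 0 0 ∣ (P * !![a, 0; b, c] * Q) i j := by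
    intro i j
    obtain ⟨u, hu⟩ := (h2 0 0 1 1 rfl rfl rfl 1 1).1
    rw [one_mul, mul_one] at hu
    fin_cases i <;> fin_cases j
    · exact dvd_rfl
    · exact (h1 0 1 (by simp)).symm ▸ dvd_zero _
    · exact (h1 1 0 (by simp)).symm ▸ dvd_zero _
    · exact ⟨u, hu⟩
  have hdA := dvd_mul_mat hD hdv P' Q'
  rw [hA] at hdA
  have hd1 : (P * !![a, 0; b, c] * Q) 0 0 ∣ 1 := by
    rw [← hxyz]
    exact dvd_add (dvd_add (duo_dvd hD _ (by simpa using hdA 0 0))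
      (duo_dvd hD _ (by simpa using hdA 1 0))) (duo_dvd hD _ (by simpa using hdA 1 1))
  obtain ⟨e, he⟩ := hd1
  have key : (P * !![a, 0; b, c] * Q) 0 0 =
      (P 0 0 * a + P 0 1 * b) * Q 0 0 + (P 0 1 * c) * Q 1 0 := by
    simp [Matrix.mul_apply, Fin.sum_univ_two]
  rw [key, add_mul, mul_assoc, mul_assoc] at he
  obtain ⟨x, hx⟩ := duo_l hD (P 0 0 * a + P 0 1 * b) (Q 0 0 * e)
  obtain ⟨y, hy⟩ := duo_l hD (P 0 1 * c) (Q 1 0 * e)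
  rw [hx, hy] at he
  obtain ⟨u, hu⟩ := duo_r hD (P 0 1) (P 0 0 * y)
  refine ⟨x * P 0 0, x * P 0 1, y * P 0 1, ⟨u, ?_⟩, ?_⟩
  · rw [mul_assoc, mul_assoc x, ← hu, ← mul_assoc (P 0 0)]
  · rw [he]; noncomm_ring

end Stmt5

/-- A Bézout duo-domain `R` is an elementary divisor ring iff whenever
`Ra + Rb + Rc = R` there are `r, s, t` with `rt ∈ sR` and `ra + sb + tc = 1`. -/
theorem stmt5 (R : Type*) [Ring R] [IsDomain R]
    (hB : IsBezoutRing R) (hD : IsDuoRing R) :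
    ElementaryDivisorRing R ↔
      ∀ a b c : R, (∃ x y z : R, x * a + y * b + z * c = 1) →
        ∃ r s t : R, (∃ u : R, r * t = s * u) ∧ r * a + s * b + t * c = 1 :=
  ⟨fun h => Stmt5.cond_of_edr hD h, fun h => Stmt5.edr_of_cond hB hD h⟩
end

section
/- Let R be a Bézout duo-domain. Then R is an elementary divisor ring if and only if R/J(R) is an elementary divisor ring, where J(R) is the Jacobson radical of R. -/
theorem aux_isUnit_of_sub_one_mem {T : Type*} [Ring T] (r : T)
    (h : r - 1 ∈ Ideal.jacobson (⊥ : Ideal T)) : IsUnit r := by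
  obtain ⟨s, hs⟩ := Ideal.exists_mul_sub_mem_of_sub_one_mem_jacobson r h
  have hs1 : s * r = 1 := sub_eq_zero.1 (by simpa using hs)
  have h2 : s - 1 ∈ Ideal.jacobson (⊥ : Ideal T) := by
    have : s - 1 = -s * (r - 1) := by rw [mul_sub, neg_mul, hs1]; simp; abel
    rw [this]
    exact Ideal.mul_mem_left _ _ h
  obtain ⟨t, ht⟩ := Ideal.exists_mul_sub_mem_of_sub_one_mem_jacobson s h2
  have ht1 : t * s = 1 := sub_eq_zero.1 (by simpa using ht)
  have : t = r := left_inv_eq_right_inv ht1 hs1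
  subst this
  exact ⟨⟨t, s, ht1, hs1⟩, rfl⟩

theorem aux_isUnit_matrix {T : Type*} [Ring T] {n : ℕ} (M : Matrix (Fin n) (Fin n) T)
    (h : ∀ i j, (M - 1) i j ∈ Ideal.jacobson (⊥ : Ideal T)) : IsUnit M := by
  apply aux_isUnit_of_sub_one_mem
  have := Ideal.matrix_jacobson_le (n := Fin n) (⊥ : Ideal T)
  rw [Ideal.matrix_bot] at this
  exact this ((Ideal.mem_matrix _ _ _).2 h)

theorem aux_isUnit_of_mul {M : Type*} [Monoid M] {a b : M} (h1 : IsUnit (a * b))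
    (h2 : IsUnit (b * a)) : IsUnit a := by
  obtain ⟨u, hu⟩ := h1
  obtain ⟨v, hv⟩ := h2
  have e1 : a * (b * ↑u⁻¹) = 1 := by rw [← mul_assoc, ← hu, Units.mul_inv]
  have e2 : (↑v⁻¹ * b) * a = 1 := by rw [mul_assoc, ← hv, Units.inv_mul]
  have e3 := left_inv_eq_right_inv e2 e1
  exact ⟨⟨a, b * ↑u⁻¹, e1, e3 ▸ e2⟩, rfl⟩

/-- invertible matrices lift modulo the Jacobson radical -/
theorem aux_lift_unit {R S : Type*} [Ring R] [Ring S] (f : R →+* S)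
    (hf : Function.Surjective f) (hk : ∀ x, f x = 0 → x ∈ Ideal.jacobson (⊥ : Ideal R))
    {n : ℕ} (M : Matrix (Fin n) (Fin n) R) (h : IsUnit (M.map f)) : IsUnit M := by
  obtain ⟨u, hu⟩ := h
  choose g hg using hf
  set L : Matrix (Fin n) (Fin n) R := (↑u⁻¹ : Matrix (Fin n) (Fin n) S).map g with hL
  have hLf : L.map f = (↑u⁻¹ : Matrix (Fin n) (Fin n) S) := by
    ext i j; simp [hL, hg]
  have key : ∀ X Y : Matrix (Fin n) (Fin n) R, X.map f * Y.map f = 1 → IsUnit (X * Y) := by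
    intro X Y h
    apply aux_isUnit_matrix
    intro i j
    apply hk
    rw [← Matrix.map_mul] at h
    have := congrFun (congrFun h i) j
    rw [Matrix.map_apply] at this
    rw [Matrix.sub_apply, map_sub, this]
    simp [Matrix.one_apply, apply_ite f]
  apply aux_isUnit_of_mul (b := L)
  · apply key; rw [hLf, ← hu]; simp
  · apply key; rw [hLf, ← hu]; simp

theorem aux_lift_unit' {R S : Type*} [Ring R] [Ring S] (f : R →+* S)
    (hf : Function.Surjective f) (hk : ∀ x, f x = 0 → x ∈ Ideal.jacobson (⊥ : Ideal R))
    (x : R) (h : IsUnit (f x)) : IsUnit x := by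
  obtain ⟨u, hu⟩ := h
  obtain ⟨y, hy⟩ := hf (↑u⁻¹)
  apply aux_isUnit_of_mul (b := y)
  · apply aux_isUnit_of_sub_one_mem; apply hk; simp [hy, ← hu]
  · apply aux_isUnit_of_sub_one_mem; apply hk; simp [hy, ← hu]

/-- block diagonal matrix -/
def auxBlk {R : Type*} [Zero R] {m n : ℕ} (u : R) (B : Matrix (Fin m) (Fin n) R) :
    Matrix (Fin (m+1)) (Fin (n+1)) R :=
  fun i j => Fin.cases (Fin.cases u (fun _ => 0) j) (fun i' => Fin.cases 0 (fun j' => B i' j') j) i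

section
variable {R : Type*} [Zero R] {m n : ℕ} (u : R) (B : Matrix (Fin m) (Fin n) R)
@[simp] theorem auxBlk_zero_zero : auxBlk u B 0 0 = u := rfl
@[simp] theorem auxBlk_zero_succ (j : Fin n) : auxBlk u B 0 j.succ = 0 := rfl
@[simp] theorem auxBlk_succ_zero (i : Fin m) : auxBlk u B i.succ 0 = 0 := rfl
@[simp] theorem auxBlk_succ_succ (i : Fin m) (j : Fin n) : auxBlk u B i.succ j.succ = B i j := rfl
end

theorem auxBlk_mul {R : Type*} [Ring R] {m n k : ℕ} (u v : R) (B : Matrix (Fin m) (Fin n) R)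
    (C : Matrix (Fin n) (Fin k) R) : auxBlk u B * auxBlk v C = auxBlk (u * v) (B * C) := by
  ext i j
  refine Fin.cases ?_ (fun i => ?_) i <;> refine Fin.cases ?_ (fun j => ?_) j <;>
    simp [Matrix.mul_apply, Fin.sum_univ_succ]

theorem auxBlk_one {R : Type*} [Ring R] {m : ℕ} :
    auxBlk (1 : R) (1 : Matrix (Fin m) (Fin m) R) = 1 := by
  ext i j
  refine Fin.cases ?_ (fun i => ?_) i <;> refine Fin.cases ?_ (fun j => ?_) j <;>
    simp [Matrix.one_apply, Fin.succ_ne_zero, (Fin.succ_ne_zero _).symm]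

theorem auxBlk_isUnit {R : Type*} [Ring R] {m : ℕ} {B : Matrix (Fin m) (Fin m) R}
    (h : IsUnit B) : IsUnit (auxBlk 1 B) := by
  obtain ⟨u, rfl⟩ := h
  exact ⟨⟨auxBlk 1 ↑u, auxBlk 1 ↑u⁻¹, by simp [auxBlk_mul, auxBlk_one],
    by simp [auxBlk_mul, auxBlk_one]⟩, rfl⟩

theorem aux_isUnit_one_sub {T : Type*} [Ring T] {N : T} (h : N * N = 0) : IsUnit (1 - N) :=
  ⟨⟨1 - N, 1 + N, by simp [mul_add, sub_mul, h], by simp [add_mul, mul_sub, h]⟩, rfl⟩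

/-- Clearing the first row and column using an invertible corner. -/
theorem aux_clear {R : Type*} [Ring R] {m n : ℕ} (C : Matrix (Fin (m+1)) (Fin (n+1)) R)
    (h : IsUnit (C 0 0)) : ∃ (P : Matrix (Fin (m+1)) (Fin (m+1)) R)
      (Q : Matrix (Fin (n+1)) (Fin (n+1)) R) (B : Matrix (Fin m) (Fin n) R),
      IsUnit P ∧ IsUnit Q ∧ P * C * Q = auxBlk (C 0 0) B := by
  obtain ⟨u, hu⟩ := h
  let N : Matrix (Fin (m+1)) (Fin (m+1)) R :=
    fun i j => Fin.cases 0 (fun i' => Fin.cases (C i'.succ 0 * ↑u⁻¹) (fun _ => 0) j) i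
  let N' : Matrix (Fin (n+1)) (Fin (n+1)) R :=
    fun i j => Fin.cases (Fin.cases 0 (fun j' => ↑u⁻¹ * C 0 j'.succ) j) (fun _ => 0) i
  have a1 : ∀ j, N 0 j = 0 := fun _ => rfl
  have a2 : ∀ i : Fin m, N i.succ 0 = C i.succ 0 * ↑u⁻¹ := fun _ => rfl
  have a3 : ∀ (i j : Fin m), N i.succ j.succ = 0 := fun _ _ => rfl
  have b1 : N' 0 0 = 0 := rfl
  have b2 : ∀ j : Fin n, N' 0 j.succ = ↑u⁻¹ * C 0 j.succ := fun _ => rfl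
  have b3 : ∀ (i : Fin n) j, N' i.succ j = 0 := fun _ _ => rfl
  clear_value N N'
  have hN : N * N = 0 := by
    ext i j
    refine Fin.cases ?_ (fun i => ?_) i <;> simp [Matrix.mul_apply, Fin.sum_univ_succ, a1, a3]
  have hN' : N' * N' = 0 := by
    ext i j
    refine Fin.cases ?_ (fun i => ?_) i <;> simp [Matrix.mul_apply, Fin.sum_univ_succ, b1, b3]
  refine ⟨1 - N, 1 - N', Matrix.of fun i j => (((1 - N) * C * (1 - N') : Matrix (Fin (m+1)) (Fin (n+1)) R)) i.succ j.succ,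
    aux_isUnit_one_sub hN, aux_isUnit_one_sub hN', ?_⟩
  have c1 : ∀ j, ((1 - N) * C : Matrix (Fin (m+1)) (Fin (n+1)) R) 0 j = C 0 j := by
    intro j; rw [Matrix.sub_mul, Matrix.one_mul, Matrix.sub_apply]; simp [Matrix.mul_apply, a1]
  have c2 : ∀ i : Fin m, ((1 - N) * C : Matrix (Fin (m+1)) (Fin (n+1)) R) i.succ 0 = 0 := by
    intro i; rw [Matrix.sub_mul, Matrix.one_mul, Matrix.sub_apply]; simp [Matrix.mul_apply, Fin.sum_univ_succ, a2, a3, mul_assoc, ← hu]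
  generalize (1 - N) * C = D at c1 c2
  ext i j
  refine Fin.cases ?_ (fun i => ?_) i <;> refine Fin.cases ?_ (fun j => ?_) j
  · rw [auxBlk_zero_zero, Matrix.mul_sub, Matrix.mul_one, Matrix.sub_apply]
    simp [Matrix.mul_apply, Fin.sum_univ_succ, b1, b3, c1]
  · rw [auxBlk_zero_succ, Matrix.mul_sub, Matrix.mul_one, Matrix.sub_apply]
    simp [Matrix.mul_apply, Fin.sum_univ_succ, b2, b3, c1, ← hu]
  · rw [auxBlk_succ_zero, Matrix.mul_sub, Matrix.mul_one, Matrix.sub_apply]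
    simp [Matrix.mul_apply, Fin.sum_univ_succ, b1, b3, c2]
  · rw [auxBlk_succ_succ, Matrix.of_apply]

/-- Diagonal form condition. -/
def AuxDiag {R : Type*} [Ring R] {m n : ℕ} (D : Matrix (Fin m) (Fin n) R) : Prop :=
    (∀ (i : Fin m) (j : Fin n), (i : ℕ) ≠ (j : ℕ) → D i j = 0) ∧
    (∀ (i : Fin m) (j : Fin n) (i' : Fin m) (j' : Fin n),
      (i : ℕ) = (j : ℕ) → (i' : ℕ) = (j' : ℕ) → (i' : ℕ) = (i : ℕ) + 1 →
      ∀ x y : R,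
        (∃ u : R, x * D i' j' * y = D i j * u) ∧
        (∃ v : R, x * D i' j' * y = v * D i j))

theorem auxDiag_blk {R : Type*} [Ring R] {m n : ℕ} {D : Matrix (Fin m) (Fin n) R}
    (hD : AuxDiag D) (u : R) (hu : IsUnit u) : AuxDiag (auxBlk u D) := by
  obtain ⟨u, rfl⟩ := hu
  refine ⟨fun i j => ?_, fun i j i' j' => ?_⟩
  · refine Fin.cases ?_ (fun i => ?_) i <;> refine Fin.cases ?_ (fun j => ?_) j
    · simp
    · simp
    · simp
    · intro h
      exact hD.1 i j (by simpa using h)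
  · refine Fin.cases ?_ (fun i => ?_) i <;> refine Fin.cases ?_ (fun j => ?_) j
    · intro _ _ _ x y
      exact ⟨⟨↑u⁻¹ * (x * auxBlk (↑u) D i' j' * y), by simp⟩,
        ⟨(x * auxBlk (↑u) D i' j' * y) * ↑u⁻¹, by simp⟩⟩
    · simp
    · simp
    · refine Fin.cases ?_ (fun i' => ?_) i' <;> refine Fin.cases ?_ (fun j' => ?_) j'
      · simp
      · simp
      · simp
      · intro h1 h2 h3
        exact hD.2 i j i' j' (by simpa using h1) (by simpa using h2) (by simpa using h3)

/-- Elementwise form of the duo condition. -/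
def AuxDuo (R : Type*) [Ring R] : Prop :=
  (∀ a r : R, ∃ s, a * r = s * a) ∧ (∀ a r : R, ∃ s, r * a = a * s)

theorem aux_duo {R : Type*} [Ring R] (h : IsDuoRing R) : AuxDuo R := by
  refine ⟨fun a r => ?_, fun a r => ?_⟩
  · have := h.1 (Ideal.span {a}) a (Ideal.subset_span rfl) r
    obtain ⟨s, hs⟩ := Ideal.mem_span_singleton'.1 this
    exact ⟨s, hs.symm⟩
  · have := h.2 (Submodule.span Rᵐᵒᵖ {a}) a (Submodule.subset_span rfl) r
    obtain ⟨s, hs⟩ := Submodule.mem_span_singleton.1 this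
    exact ⟨s.unop, hs.symm⟩

theorem aux_duo_map {R S : Type*} [Ring R] [Ring S] (f : R →+* S)
    (hf : Function.Surjective f) (h : AuxDuo R) : AuxDuo S := by
  refine ⟨fun a r => ?_, fun a r => ?_⟩ <;> obtain ⟨a, rfl⟩ := hf a <;> obtain ⟨r, rfl⟩ := hf r
  · obtain ⟨s, hs⟩ := h.1 a r
    exact ⟨f s, by rw [← map_mul, hs, map_mul]⟩
  · obtain ⟨s, hs⟩ := h.2 a r
    exact ⟨f s, by rw [← map_mul, hs, map_mul]⟩

/-- Over a duo ring, the corner of a diagonal matrix with unimodular entries is a unit. -/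
theorem aux_corner {S : Type*} [Ring S] (hS : AuxDuo S) {m n : ℕ}
    (A : Matrix (Fin (m+1)) (Fin (n+1)) S) (P : Matrix (Fin (m+1)) (Fin (m+1)) S)
    (Q : Matrix (Fin (n+1)) (Fin (n+1)) S) (hP : IsUnit P) (hQ : IsUnit Q)
    (hD : AuxDiag (P * A * Q)) (c : Fin (m+1) × Fin (n+1) → S)
    (hc : ∑ k, A k.1 k.2 * c k = 1) : IsUnit ((P * A * Q) 0 0) := by
  obtain ⟨P, rfl⟩ := hP
  obtain ⟨Q, rfl⟩ := hQ
  set D : Matrix (Fin (m+1)) (Fin (n+1)) S := P.val * A * Q.val with hDdef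
  have hA : A = P⁻¹.val * D * Q⁻¹.val := by
    rw [hDdef]
    simp only [Matrix.mul_assoc]
    rw [Units.mul_inv, ← Matrix.mul_assoc, Units.inv_mul]; simp
  have diag : ∀ (k : ℕ) (i : Fin (m+1)) (j : Fin (n+1)), (i : ℕ) = k → (j : ℕ) = k →
      ∀ x y : S, D 0 0 ∣ x * D i j * y := by
    intro k
    induction k with
    | zero =>
      intro i j hi hj x y
      obtain rfl : i = 0 := Fin.ext hi
      obtain rfl : j = 0 := Fin.ext hj
      obtain ⟨s, hs⟩ := hS.2 (D 0 0) x
      rw [hs, mul_assoc]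
      exact dvd_mul_right _ _
    | succ k ih =>
      intro i j hi hj x y
      obtain ⟨⟨u, hu⟩, -⟩ := hD.2 ⟨k, by omega⟩ ⟨k, by omega⟩ i j rfl (by omega) (by simp [hi]) x y
      rw [hu]
      simpa using ih ⟨k, by omega⟩ ⟨k, by omega⟩ rfl rfl 1 u
  have all : ∀ i j (x y : S), D 0 0 ∣ x * D i j * y := by
    intro i j x y
    by_cases h : (i : ℕ) = j
    · exact diag _ i j rfl h.symm x y
    · rw [hD.1 i j h]; simp
  have h1 : D 0 0 ∣ 1 := by
    rw [← hc]
    refine Finset.dvd_sum fun k _ => Dvd.dvd.mul_right ?_ _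
    rw [hA, Matrix.mul_apply]
    refine Finset.dvd_sum fun j _ => ?_
    rw [Matrix.mul_apply, Finset.sum_mul]
    exact Finset.dvd_sum fun i _ => all _ _ _ _
  obtain ⟨u, hu⟩ := h1
  obtain ⟨v, hv⟩ := hS.1 (D 0 0) u
  have hv1 : v * D 0 0 = 1 := by rw [← hv, ← hu]
  have := left_inv_eq_right_inv hv1 hu.symm
  subst this
  exact ⟨⟨D 0 0, v, hu.symm, hv1⟩, rfl⟩

/-- Moving an invertible matrix past a scalar. -/
theorem aux_move {R : Type*} [Ring R] [IsDomain R] (hR : AuxDuo R) (d : R) (hd : d ≠ 0) {m : ℕ}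
    (P : Matrix (Fin m) (Fin m) R) (hP : IsUnit P) :
    ∃ P' : Matrix (Fin m) (Fin m) R, IsUnit P' ∧
      P' * Matrix.diagonal (fun _ => d) = Matrix.diagonal (fun _ => d) * P := by
  obtain ⟨P, rfl⟩ := hP
  have mv : ∀ X : Matrix (Fin m) (Fin m) R, ∃ X' : Matrix (Fin m) (Fin m) R,
      X' * Matrix.diagonal (fun _ => d) = Matrix.diagonal (fun _ => d) * X := by
    intro X
    choose g hg using hR.1 d
    refine ⟨X.map g, ?_⟩
    ext i j
    simp [hg (X i j)]
  have cancel : ∀ X Y : Matrix (Fin m) (Fin m) R, X * Matrix.diagonal (fun _ => d) =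
      Y * Matrix.diagonal (fun _ => d) → X = Y := by
    intro X Y h
    ext i j
    have := congrFun (congrFun h i) j
    simpa [hd] using this
  obtain ⟨X, hX⟩ := mv ↑P
  obtain ⟨Y, hY⟩ := mv ↑P⁻¹
  refine ⟨X, ⟨⟨X, Y, ?_, ?_⟩, rfl⟩, hX⟩
  · apply cancel
    rw [mul_assoc, hY, ← mul_assoc, hX, mul_assoc, Units.mul_inv]; simp
  · apply cancel
    rw [mul_assoc, hX, ← mul_assoc, hY, mul_assoc, Units.inv_mul]; simp

theorem auxDiag_scale {R : Type*} [Ring R] (hR : AuxDuo R) (d : R) {m n : ℕ}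
    {D : Matrix (Fin m) (Fin n) R} (hD : AuxDiag D) :
    AuxDiag ((Matrix.diagonal (fun _ => d) : Matrix (Fin m) (Fin m) R) * D) := by
  refine ⟨fun i j h => by simp [hD.1 i j h], fun i j i' j' h1 h2 h3 x y => ?_⟩
  obtain ⟨x', hx⟩ := hR.2 d x
  obtain ⟨⟨u, hu⟩, ⟨v, hv⟩⟩ := hD.2 i j i' j' h1 h2 h3 x' y
  obtain ⟨v', hv'⟩ := hR.1 d v
  simp only [Matrix.diagonal_mul]
  have e : x * (d * D i' j') * y = d * (x' * D i' j' * y) := by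
    rw [← mul_assoc x, hx]; simp only [mul_assoc]
  refine ⟨⟨u, ?_⟩, ⟨v', ?_⟩⟩
  · rw [e, hu, mul_assoc]
  · rw [e, hv, ← mul_assoc, hv', mul_assoc]

theorem aux_main {R S : Type*} [Ring R] [IsDomain R] [Ring S] (f : R →+* S)
    (hf : Function.Surjective f) (hk : ∀ x, f x = 0 → x ∈ Ideal.jacobson (⊥ : Ideal R))
    (hB : IsBezoutRing R) (hR : AuxDuo R) (hS : ElementaryDivisorRing S) :
    ElementaryDivisorRing R := by
  intro m
  induction m with
  | zero =>
    intro n A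
    exact ⟨1, 1, isUnit_one, isUnit_one, fun i => i.elim0, fun i => i.elim0⟩
  | succ m ih =>
    intro n A
    cases n with
    | zero => exact ⟨1, 1, isUnit_one, isUnit_one, fun _ j => j.elim0, fun _ j => j.elim0⟩
    | succ n =>
    by_cases hA : A = 0
    · subst hA
      exact ⟨1, 1, isUnit_one, isUnit_one, by simp, by simp⟩
    obtain ⟨d, hd⟩ := hB.2 (Submodule.span Rᵐᵒᵖ
      (Set.range fun k : Fin (m+1) × Fin (n+1) => A k.1 k.2))
      (Submodule.fg_span (Set.finite_range _))
    have h1 : ∀ i j, ∃ a, A i j = d * a := by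
      intro i j
      have : A i j ∈ Submodule.span Rᵐᵒᵖ {d} := by
        rw [← hd]; exact Submodule.subset_span ⟨(i, j), rfl⟩
      obtain ⟨s, hs⟩ := Submodule.mem_span_singleton.1 this
      exact ⟨s.unop, hs.symm⟩
    choose A' hA' using h1
    have hAd : A = (Matrix.diagonal (fun _ => d) : Matrix (Fin (m+1)) (Fin (m+1)) R) * Matrix.of A' := by
      ext i j; simp [hA']
    have hd0 : d ≠ 0 := by
      rintro rfl
      apply hA
      ext i j
      simp [hA']
    have hdm : d ∈ Submodule.span Rᵐᵒᵖ
      (Set.range fun k : Fin (m+1) × Fin (n+1) => A k.1 k.2) := by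
      rw [hd]; exact Submodule.subset_span rfl
    obtain ⟨c, hc⟩ := (Submodule.mem_span_range_iff_exists_fun _).1 hdm
    have hc' : ∑ k : Fin (m+1) × Fin (n+1), A' k.1 k.2 * (c k).unop = 1 := by
      apply mul_left_cancel₀ hd0
      rw [Finset.mul_sum, mul_one]
      conv_rhs => rw [← hc]
      refine Finset.sum_congr rfl fun k _ => ?_
      rw [← mul_assoc, ← hA']; rfl
    obtain ⟨P, Q, hP, hQ, hD⟩ := hS _ _ ((Matrix.of A').map f)
    have hcor := aux_corner (aux_duo_map f hf hR) _ P Q hP hQ hD (fun k => f (c k).unop)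
      (by rw [← map_one f, ← hc', map_sum]; simp)
    choose g hg using id hf
    have hPg : (P.map g).map f = P := by ext; simp [hg]
    have hQg : (Q.map g).map f = Q := by ext; simp [hg]
    have hP1 : IsUnit (P.map g) := aux_lift_unit f hf hk _ (by rwa [hPg])
    have hQ1 : IsUnit (Q.map g) := aux_lift_unit f hf hk _ (by rwa [hQg])
    have hcor' : IsUnit ((P.map g * Matrix.of A' * Q.map g) 0 0) := by
      apply aux_lift_unit' f hf hk
      rw [← Matrix.map_apply (f := f) (M := P.map g * Matrix.of A' * Q.map g), Matrix.map_mul,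
        Matrix.map_mul, hPg, hQg]
      exact hcor
    obtain ⟨P2, Q2, B, hP2, hQ2, hB2⟩ := aux_clear _ hcor'
    obtain ⟨P3, Q3, hP3, hQ3, hD3⟩ := ih n B
    have hPP : IsUnit (auxBlk 1 P3 * P2 * P.map g) := ((auxBlk_isUnit hP3).mul hP2).mul hP1
    obtain ⟨P', hP', hmove⟩ := aux_move hR d hd0 _ hPP
    refine ⟨P', Q.map g * Q2 * auxBlk 1 Q3, hP', (hQ1.mul hQ2).mul (auxBlk_isUnit hQ3), ?_⟩
    have e : P' * A * (Q.map g * Q2 * auxBlk 1 Q3) =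
        (Matrix.diagonal (fun _ => d) : Matrix (Fin (m+1)) (Fin (m+1)) R) *
        auxBlk ((P.map g * Matrix.of A' * Q.map g) 0 0) (P3 * B * Q3) := by
      rw [hAd, ← Matrix.mul_assoc P', hmove]
      have : auxBlk ((P.map g * Matrix.of A' * Q.map g) 0 0) (P3 * B * Q3) =
        auxBlk 1 P3 * (P2 * (P.map g * Matrix.of A' * Q.map g) * Q2) * auxBlk 1 Q3 := by
        rw [hB2, auxBlk_mul, auxBlk_mul]; simp
      rw [this]
      simp only [Matrix.mul_assoc]
    rw [e]
    exact auxDiag_scale hR d (auxDiag_blk hD3 _ hcor')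

theorem aux_forward {R S : Type*} [Ring R] [Ring S] (f : R →+* S)
    (hf : Function.Surjective f) (hR : ElementaryDivisorRing R) : ElementaryDivisorRing S := by
  intro m n A
  choose g hg using id hf
  obtain ⟨P, Q, hP, hQ, h1, h2⟩ := hR m n (A.map g)
  have e : P.map f * A * Q.map f = (P * A.map g * Q).map f := by
    rw [Matrix.map_mul, Matrix.map_mul]
    congr 2
    ext; simp [hg]
  refine ⟨P.map f, Q.map f, hP.map f.mapMatrix, hQ.map f.mapMatrix, ?_, ?_⟩
  · intro i j h
    rw [e, Matrix.map_apply, h1 i j h, map_zero]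
  · intro i j i' j' a b c x y
    obtain ⟨x, rfl⟩ := hf x
    obtain ⟨y, rfl⟩ := hf y
    obtain ⟨⟨u, hu⟩, ⟨v, hv⟩⟩ := h2 i j i' j' a b c x y
    rw [e]
    simp only [Matrix.map_apply]
    exact ⟨⟨f u, by simp only [← map_mul, hu]⟩, ⟨f v, by simp only [← map_mul, hv]⟩⟩

/-- A Bézout duo-domain `R` is an elementary divisor ring iff `R/J(R)`
is an elementary divisor ring. -/
theorem stmt6 (R : Type*) [Ring R] [IsDomain R]
    (hB : IsBezoutRing R) (hD : IsDuoRing R) :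
    ElementaryDivisorRing R ↔
      ElementaryDivisorRing
        ((TwoSidedIdeal.span ((jacobsonRadical R : Ideal R) : Set R)).ringCon.Quotient) := by
  have hs := RingCon.mk'_surjective
    (c := (TwoSidedIdeal.span ((jacobsonRadical R : Ideal R) : Set R)).ringCon)
  refine ⟨aux_forward _ hs, aux_main _ hs ?_ hB (aux_duo hD)⟩
  intro x hx
  have h1 : (TwoSidedIdeal.span ((jacobsonRadical R : Ideal R) : Set R)).ringCon x 0 :=
    (RingCon.eq _).1 hx
  have h2 : x ∈ TwoSidedIdeal.span ((jacobsonRadical R : Ideal R) : Set R) := h1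
  have h3 : TwoSidedIdeal.span ((jacobsonRadical R : Ideal R) : Set R) ≤
      (jacobsonRadical R).toTwoSided := TwoSidedIdeal.span_le.2 (by simp)
  exact Ideal.mem_toTwoSided.1 (h3 h2)
end

section
/- Every locally stable Bézout duo-domain is an elementary divisor ring. -/
namespace EDR

theorem duoR {R : Type*} [Ring R] (hD : IsDuoRing R) (a r : R) : ∃ r' : R, r * a = a * r' := by
  have h := hD.2 (Submodule.span Rᵐᵒᵖ {a}) a (Submodule.mem_span_singleton_self a) r
  obtain ⟨s, hs⟩ := Submodule.mem_span_singleton.1 h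
  exact ⟨s.unop, by rw [← hs]; rfl⟩

theorem duoL {R : Type*} [Ring R] (hD : IsDuoRing R) (a r : R) : ∃ r' : R, a * r = r' * a := by
  have h := hD.1 (Ideal.span {a}) a (Ideal.mem_span_singleton_self a) r
  obtain ⟨s, hs⟩ := Submodule.mem_span_singleton.1 h
  exact ⟨s, by rw [← hs]; rfl⟩

theorem bez {R : Type*} [Ring R] (hB : IsBezoutRing R) {n : ℕ} (a : Fin n → R) :
    ∃ q : Fin n → R, ∀ j, (∑ i, a i * q i) ∣ a j := by
  obtain ⟨d, hd⟩ := hB.2 (Submodule.span Rᵐᵒᵖ (Set.range a))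
    (Submodule.fg_span (Set.finite_range a))
  have h1 : d ∈ Submodule.span Rᵐᵒᵖ (Set.range a) := by
    rw [hd]; exact Submodule.mem_span_singleton_self d
  obtain ⟨c, hc⟩ := (Submodule.mem_span_range_iff_exists_fun Rᵐᵒᵖ).1 h1
  refine ⟨fun i => (c i).unop, fun j => ?_⟩
  have h2 : a j ∈ Submodule.span Rᵐᵒᵖ {d} := by
    rw [← hd]; exact Submodule.subset_span ⟨j, rfl⟩
  obtain ⟨s, hs⟩ := Submodule.mem_span_singleton.1 h2
  have h3 : (∑ i, a i * (c i).unop) = d := by rw [← hc]; rfl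
  rw [h3]
  exact ⟨s.unop, by rw [← hs]; rfl⟩

theorem bez2 {R : Type*} [Ring R] (hB : IsBezoutRing R) (a b : R) :
    ∃ x y : R, (a * x + b * y) ∣ a ∧ (a * x + b * y) ∣ b := by
  obtain ⟨q, hq⟩ := bez hB ![a, b]
  refine ⟨q 0, q 1, ?_, ?_⟩
  · simpa [Fin.sum_univ_two] using hq 0
  · simpa [Fin.sum_univ_two] using hq 1

/-- divisibility is two-sided -/
theorem dvd_mul3 {R : Type*} [Ring R] (hD : IsDuoRing R) {d a : R} (h : d ∣ a) (x y : R) :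
    d ∣ x * a * y := by
  obtain ⟨c, rfl⟩ := h
  obtain ⟨x', hx⟩ := duoR hD d x
  exact ⟨x' * c * y, by simp only [← mul_assoc]; rw [hx]⟩

theorem dvd_left {R : Type*} [Ring R] (hD : IsDuoRing R) {d a : R} (h : d ∣ a) :
    ∃ v, a = v * d := by
  obtain ⟨c, rfl⟩ := h
  exact duoL hD d c

theorem stab {R : Type*} [Ring R] (hD : IsDuoRing R) {b g a c x y : R}
    (hs : HasStableRange1 (QuotBy b)) (hg : g ∣ b) (h : a * x + c * y = 1) :
    ∃ z w h : R, (a + c * z) * w + g * h = 1 := by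
  let π : R →+* QuotBy b := (TwoSidedIdeal.span {b}).ringCon.mk'
  have hπ : Function.Surjective π := RingCon.mk'_surjective _
  obtain ⟨z, hz⟩ := hs (π a) (π c) ⟨π x, π y, by rw [← map_mul, ← map_mul, ← map_add, h, map_one]⟩
  obtain ⟨z, rfl⟩ := hπ z
  obtain ⟨w, hw⟩ := hz.exists_right_inv
  obtain ⟨w, rfl⟩ := hπ w
  rw [← map_mul, ← map_add, ← map_mul, ← map_one π] at hw
  have h1 : (TwoSidedIdeal.span {b}).ringCon 1 ((a + c * z) * w) := by
    have := (RingCon.eq (TwoSidedIdeal.span {b}).ringCon).1 hw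
    exact (TwoSidedIdeal.span {b}).ringCon.symm this
  rw [TwoSidedIdeal.rel_iff, TwoSidedIdeal.mem_span_iff] at h1
  let I : TwoSidedIdeal R := TwoSidedIdeal.mk' {x | g ∣ x} (dvd_zero g)
    (fun h1 h2 => dvd_add h1 h2) (fun h => (dvd_neg).2 h)
    (fun {x y} h => by simpa using dvd_mul3 hD h x 1)
    (fun {x y} h => by simpa using dvd_mul3 hD h 1 y)
  have h2 : 1 - (a + c * z) * w ∈ I := h1 I (by
    intro t ht
    rw [Set.mem_singleton_iff] at ht
    subst ht
    simpa [I, TwoSidedIdeal.mem_mk'] using hg)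
  have h3 : g ∣ 1 - (a + c * z) * w := by simpa [I, TwoSidedIdeal.mem_mk'] using h2
  obtain ⟨k, hk⟩ := h3
  exact ⟨z, w, k, by rw [← hk]; abel⟩

theorem core1 {R : Type*} [Ring R] [IsDomain R] (hB : IsBezoutRing R) (hD : IsDuoRing R)
    {a b c x y z : R} (hs : HasStableRange1 (QuotBy b)) (h : a * x + b * y + c * z = 1) :
    ∃ p q u v : R, (p * a + q * b) * u + q * c * v = 1 := by
  obtain ⟨x1, y1, ha, hb⟩ := bez2 hB a b
  set g := a * x1 + b * y1 with hg
  by_cases g0 : g = 0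
  · rw [g0, zero_dvd_iff] at ha hb
    refine ⟨0, 1, 0, z, ?_⟩
    rw [ha, hb] at h
    simpa using h
  have hg' : ∃ p0 q0 : R, g = p0 * a + q0 * b := by
    obtain ⟨p0, hp⟩ := duoL hD a x1
    obtain ⟨q0, hq⟩ := duoL hD b y1
    exact ⟨p0, q0, by rw [hg, hp, hq]⟩
  obtain ⟨p0, q0, hpq⟩ := hg'
  obtain ⟨a', ha'⟩ := dvd_left hD ha
  obtain ⟨b', hb'⟩ := dvd_left hD hb
  have h1 : p0 * a' + q0 * b' = 1 := by
    apply mul_right_cancel₀ g0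
    rw [add_mul, mul_assoc, mul_assoc, ← ha', ← hb', ← hpq, one_mul]
  obtain ⟨p0', hp0'⟩ := duoR hD a' p0
  obtain ⟨ρ, hρ⟩ := duoL hD a' b'
  obtain ⟨t, w, k, htw⟩ := stab hD (a := q0) (c := a') (x := b') (y := p0') hs hb
    (by rw [← hp0', add_comm]; exact h1)
  obtain ⟨t', ht'⟩ := duoL hD a' t
  rw [ht'] at htw
  have h2 : (p0 - t' * ρ) * a + (q0 + t' * a') * b = g := by
    have : (p0 - t' * ρ) * a' + (q0 + t' * a') * b' = 1 := by
      rw [sub_mul, add_mul, mul_assoc t' a', hρ, ← mul_assoc, ← h1]; abel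
    calc _ = ((p0 - t' * ρ) * a' + (q0 + t' * a') * b') * g := by
          rw [add_mul _ _ g, mul_assoc _ a' g, mul_assoc _ b' g, ← ha', ← hb']
      _ = g := by rw [this, one_mul]
  obtain ⟨a2, ha2⟩ := ha
  obtain ⟨b2, hb2⟩ := hb
  have h3 : c * z + g * (a2 * x + b2 * y) = 1 := by
    rw [mul_add, ← mul_assoc, ← mul_assoc, ← ha2, ← hb2, ← h]; abel
  set q := q0 + t' * a' with hq
  set e := a2 * x + b2 * y
  obtain ⟨f, hf⟩ := duoR hD g q
  refine ⟨p0 - t' * ρ, q, f * e * w + k, z * w, ?_⟩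
  rw [h2]
  calc _ = q * (c * z) * w + (g * f) * e * w + g * k := by noncomm_ring
    _ = q * (c * z + g * e) * w + g * k := by rw [← hf]; noncomm_ring
    _ = 1 := by rw [h3, mul_one, htw]

theorem core2 {R : Type*} [Ring R] [IsDomain R] (hB : IsBezoutRing R) (hD : IsDuoRing R)
    (hLS : ∀ a b : R, (∃ x y : R, a * x + b * y = 1) →
      ∃ y : R, HasStableRange1 (QuotBy (a + b * y)))
    {a b c x y z : R} (h : a * x + b * y + c * z = 1) :
    ∃ p q u v : R, (p * a + q * b) * u + q * c * v = 1 := by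
  obtain ⟨t, ht⟩ := hLS b (a * x + c * z) ⟨y, 1, by rw [mul_one, ← h]; abel⟩
  obtain ⟨p, q, u, v, hp⟩ := core1 (c := c) (a := a) (x := x - x * t * y) (y := y)
    (z := z - z * t * y) hB hD ht (by
      rw [← h]; noncomm_ring)
  obtain ⟨x', hx'⟩ := duoL hD a (x * t)
  refine ⟨p + q * x', q, u, z * t * u + v, ?_⟩
  rw [← hp]
  have : b + (a * x + c * z) * t = b + x' * a + c * (z * t) := by
    rw [← hx']; noncomm_ring
  rw [this]; noncomm_ring

theorem core3 {R : Type*} [Ring R] [IsDomain R] (hB : IsBezoutRing R) (hD : IsDuoRing R)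
    (hLS : ∀ a b : R, (∃ x y : R, a * x + b * y = 1) →
      ∃ y : R, HasStableRange1 (QuotBy (a + b * y)))
    (a b c : R) (ha : a ≠ 0) :
    ∃ p q u v : R, ((p * a + q * b) * u + q * c * v) ∣ a ∧
      ((p * a + q * b) * u + q * c * v) ∣ b ∧ ((p * a + q * b) * u + q * c * v) ∣ c := by
  obtain ⟨r, hr⟩ := bez hB ![a, b, c]
  simp only [Fin.sum_univ_three] at hr
  have hra := hr 0
  have hrb := hr 1
  have hrc := hr 2
  simp only [Matrix.cons_val] at hra hrb hrc
  set d := a * r 0 + b * r 1 + c * r 2 with hd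
  obtain ⟨a', ha'⟩ := id hra
  obtain ⟨b', hb'⟩ := id hrb
  obtain ⟨c', hc'⟩ := id hrc
  have d0 : d ≠ 0 := by
    intro h; rw [h, zero_mul] at ha'; exact ha ha'
  obtain ⟨p, q, u, v, h⟩ := core2 hB hD hLS (a := a') (b := b') (c := c')
    (x := r 0) (y := r 1) (z := r 2) (by
      apply mul_left_cancel₀ d0
      rw [mul_add, mul_add, ← mul_assoc, ← mul_assoc, ← mul_assoc, ← ha', ← hb', ← hc', mul_one])
  obtain ⟨p', hp'⟩ := duoL hD d p
  obtain ⟨q', hq'⟩ := duoL hD d q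
  have : (p' * a + q' * b) * u + q' * c * v = d := by
    calc _ = (p' * d * a' + q' * d * b') * u + q' * d * c' * v := by
          simp only [mul_assoc]; simp only [← mul_assoc d, ← ha', ← hb', ← hc']
      _ = d * ((p * a' + q * b') * u + q * c' * v) := by rw [← hp', ← hq']; noncomm_ring
      _ = d := by rw [h, mul_one]
  exact ⟨p', q', u, v, by rw [this]; exact ⟨hra, hrb, hrc⟩⟩

theorem dvd_vecMul {R : Type*} [Ring R] (hD : IsDuoRing R) {m n : ℕ} {d : R}
    {A : Matrix (Fin m) (Fin n) R}
    (h : ∀ i j, d ∣ A i j) (p : Fin m → R) (j : Fin n) : d ∣ (∑ i, p i * A i j) :=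
  Finset.dvd_sum fun i _ => by simpa using dvd_mul3 hD (h i j) (p i) 1

theorem reach {R : Type*} [Ring R] [IsDomain R] (hB : IsBezoutRing R) (hD : IsDuoRing R)
    (hLS : ∀ a b : R, (∃ x y : R, a * x + b * y = 1) →
      ∃ y : R, HasStableRange1 (QuotBy (a + b * y)))
    (n : ℕ) : ∀ (m : ℕ) (A : Matrix (Fin m) (Fin n) R),
    ∃ (p : Fin m → R) (q : Fin n → R), ∀ i j, (∑ j, (∑ i, p i * A i j) * q j) ∣ A i j := by
  intro m
  induction m with
  | zero => intro A; exact ⟨0, 0, fun i => i.elim0⟩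
  | succ m ih =>
    intro A
    obtain ⟨p', q', h⟩ := ih (fun i j => A i.succ j)
    set e := ∑ j, (∑ i, p' i * A i.succ j) * q' j with he
    by_cases e0 : e = 0
    · obtain ⟨q, hq⟩ := bez hB (A 0)
      refine ⟨Fin.cons 1 0, q, fun i j => ?_⟩
      simp only [Fin.sum_univ_succ, Fin.cons_zero, one_mul, Fin.cons_succ, Pi.zero_apply, zero_mul,
        Finset.sum_const_zero, add_zero]
      refine Fin.cases ?_ (fun i => ?_) i
      · exact hq j
      · have := h i j
        rw [e0, zero_dvd_iff] at this
        rw [this]; exact dvd_zero _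
    · have hw : ∀ j, ∃ w, (∑ i, p' i * A i.succ j) = e * w := fun j =>
        dvd_vecMul hD (A := fun i j => A (Fin.succ i) j) h p' j
      choose w hw using hw
      have hwq : ∑ j, w j * q' j = 1 := by
        apply mul_left_cancel₀ e0
        rw [Finset.mul_sum, mul_one]
        conv_rhs => rw [he]
        simp only [hw, mul_assoc]
      set a1 := ∑ j, A 0 j * q' j with ha1
      obtain ⟨k, hk⟩ := bez hB (fun j => A 0 j - a1 * w j)
      set g := ∑ j, (A 0 j - a1 * w j) * k j with hg
      set s := ∑ j, w j * k j with hs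
      have hwk : ∑ j, w j * (k j - q' j * s) = 0 := by
        simp only [mul_sub, Finset.sum_sub_distrib, ← mul_assoc, ← Finset.sum_mul, hwq]
        rw [← hs, one_mul, sub_self]
      have hak : ∑ j, A 0 j * (k j - q' j * s) = g := by
        rw [hg]
        simp only [mul_sub, sub_mul, Finset.sum_sub_distrib, ← mul_assoc, ← Finset.sum_mul]
        simp only [mul_assoc, ← Finset.mul_sum]
        rw [← hs, ← ha1]
      obtain ⟨p, q, u, v, h1, h2, h3⟩ := core3 hB hD hLS e a1 g e0
      have hfin : (∑ j, (∑ i, (Fin.cons q (fun i => p * p' i) : Fin (m+1) → R) i * A i j) *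
          (q' j * u + (k j - q' j * s) * v)) = (p * e + q * a1) * u + q * g * v := by
        simp only [Fin.sum_univ_succ, Fin.cons_zero, Fin.cons_succ, mul_assoc, ← Finset.mul_sum, hw]
        have e1 : ∀ j, (q * A 0 j + p * (e * w j)) * (q' j * u + (k j - q' j * s) * v)
          = q * ((A 0 j * q' j) * u) + q * ((A 0 j * (k j - q' j * s)) * v)
            + p * (e * ((w j * q' j) * u)) + p * (e * ((w j * (k j - q' j * s)) * v)) := by
          intro j; noncomm_ring
        simp only [e1, Finset.sum_add_distrib, ← Finset.mul_sum, ← Finset.sum_mul]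
        rw [hwk, hak, hwq, ← ha1]
        noncomm_ring
      refine ⟨Fin.cons q (fun i => p * p' i),
        fun j => (q' j * u + (k j - q' j * s) * v), fun i j => ?_⟩
      rw [hfin]
      refine Fin.cases ?_ (fun i => ?_) i
      · have : A 0 j = (A 0 j - a1 * w j) + a1 * w j := by abel
        rw [this]
        exact dvd_add (h3.trans (hk j)) (h2.mul_right _)
      · exact h1.trans (h i j)

/-- block diagonal -/
def blk {R : Type*} [Ring R] {m n : ℕ} (a : R) (M : Matrix (Fin m) (Fin n) R) :
    Matrix (Fin (m + 1)) (Fin (n + 1)) R :=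
  Matrix.of (Fin.cons (Fin.cons a 0) (fun i => Fin.cons 0 (M i)))

theorem blk_mul {R : Type*} [Ring R] {m n k : ℕ} (a b : R) (M : Matrix (Fin m) (Fin n) R)
    (N : Matrix (Fin n) (Fin k) R) : blk a M * blk b N = blk (a * b) (M * N) := by
  ext i j
  refine Fin.cases ?_ (fun i => ?_) i <;> refine Fin.cases ?_ (fun j => ?_) j <;>
    simp [blk, Matrix.mul_apply, Fin.sum_univ_succ]

theorem blk_one {R : Type*} [Ring R] {n : ℕ} :
    blk (1 : R) (1 : Matrix (Fin n) (Fin n) R) = 1 := by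
  ext i j
  refine Fin.cases ?_ (fun i => ?_) i <;> refine Fin.cases ?_ (fun j => ?_) j <;>
    simp [blk, Matrix.one_apply, Fin.succ_ne_zero, (Fin.succ_ne_zero _).symm]

theorem blk_unit {R : Type*} [Ring R] {n : ℕ} {a : R} {M : Matrix (Fin n) (Fin n) R}
    (ha : IsUnit a) (hM : IsUnit M) : IsUnit (blk a M) := by
  obtain ⟨a, rfl⟩ := ha
  obtain ⟨M, rfl⟩ := hM
  refine ⟨⟨blk a M, blk (↑a⁻¹) (↑M⁻¹), ?_, ?_⟩, rfl⟩ <;> rw [blk_mul] <;> simp [blk_one]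

/-- two by two block plus identity -/
def blk2 {R : Type*} [Ring R] (n : ℕ) (a b c d : R) : Matrix (Fin (n + 2)) (Fin (n + 2)) R :=
  Matrix.of (Fin.cons (Fin.cons a (Fin.cons b 0)) (Fin.cons (Fin.cons c (Fin.cons d 0))
    (fun i => Fin.cons 0 (Fin.cons 0 ((1 : Matrix (Fin n) (Fin n) R) i)))))

theorem blk2_mul {R : Type*} [Ring R] {n : ℕ} (a b c d x y z w : R) :
    blk2 n a b c d * blk2 n x y z w =
      blk2 n (a * x + b * z) (a * y + b * w) (c * x + d * z) (c * y + d * w) := by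
  ext i j
  refine Fin.cases ?_ (fun i => Fin.cases ?_ (fun i => ?_) i) i <;>
  refine Fin.cases ?_ (fun j => Fin.cases ?_ (fun j => ?_) j) j <;>
    simp [blk2, Matrix.mul_apply, Fin.sum_univ_succ, Matrix.one_apply]

theorem blk2_one {R : Type*} [Ring R] {n : ℕ} : blk2 n (1 : R) 0 0 1 = 1 := by
  have : blk2 n (1 : R) 0 0 1 = blk 1 (blk 1 1) := by
    ext i j
    refine Fin.cases ?_ (fun i => Fin.cases ?_ (fun i => ?_) i) i <;>
    refine Fin.cases ?_ (fun j => Fin.cases ?_ (fun j => ?_) j) j <;>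
      simp [blk2, blk]
  rw [this, blk_one, blk_one]

theorem complete2 {R : Type*} [Ring R] [IsDomain R] (hB : IsBezoutRing R) {a b x y : R}
    (h : a * x + b * y = 1) (n : ℕ) : ∃ c d : R, IsUnit (blk2 n a b c d) := by
  suffices H : ∃ c d g k : R, a * g + b * k = 0 ∧ c * x + d * y = 0 ∧ c * g + d * k = 1 ∧
      x * a + g * c = 1 ∧ x * b + g * d = 0 ∧ y * a + k * c = 0 ∧ y * b + k * d = 1 by
    obtain ⟨c, d, g, k, h1, h2, h3, h4, h5, h6, h7⟩ := H
    refine ⟨c, d, ⟨blk2 n a b c d, blk2 n x g y k, ?_, ?_⟩, rfl⟩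
    · rw [blk2_mul, h, h1, h2, h3, blk2_one]
    · rw [blk2_mul, h4, h5, h6, h7, blk2_one]
  by_cases b0 : b = 0
  · subst b0
    have h' : a * x = 1 := by simpa using h
    have h'' : x * a = 1 := mul_eq_one_comm.1 h'
    refine ⟨-(y * a), 1, 0, 1, ?_, ?_, ?_, ?_, ?_, ?_, ?_⟩ <;> simp [h'', mul_assoc, h']
  obtain ⟨s, t, ⟨c, hc⟩, ⟨d, hd⟩⟩ := bez2 hB (1 - x * a) (-(x * b))
  set g := (1 - x * a) * s + -(x * b) * t with hg
  set k := -(y * a) * s + (1 - y * b) * t with hk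
  have h1 : a * g + b * k = 0 := by
    calc _ = (1 - (a * x + b * y)) * (a * s + b * t) := by rw [hg, hk]; noncomm_ring
      _ = 0 := by rw [h, sub_self, zero_mul]
  have h4 : x * a + g * c = 1 := by rw [← hc]; abel
  have h5 : x * b + g * d = 0 := by rw [← hd]; abel
  have g0 : g ≠ 0 := by
    intro g0
    rw [g0, zero_mul, add_zero] at h4 h5
    rcases mul_eq_zero.1 h5 with h | h
    · rw [h, zero_mul] at h4; exact zero_ne_one h4
    · exact b0 h
  have h6 : y * a + k * c = 0 := by
    apply mul_left_cancel₀ b0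
    calc _ = (a * x + b * y) * a + (a * g + b * k) * c - a * (x * a + g * c) := by noncomm_ring
      _ = _ := by rw [h, h1, h4]; noncomm_ring
  have h7 : y * b + k * d = 1 := by
    apply mul_left_cancel₀ b0
    calc _ = (a * x + b * y) * b + (a * g + b * k) * d - a * (x * b + g * d) := by noncomm_ring
      _ = _ := by rw [h, h1, h5]; noncomm_ring
  refine ⟨c, d, g, k, h1, ?_, ?_, h4, h5, h6, h7⟩
  · apply mul_left_cancel₀ g0
    calc _ = (x * a + g * c) * x + (x * b + g * d) * y - x * (a * x + b * y) := by noncomm_ring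
      _ = _ := by rw [h, h4, h5]; noncomm_ring
  · apply mul_left_cancel₀ g0
    calc _ = (x * a + g * c) * g + (x * b + g * d) * k - x * (a * g + b * k) := by noncomm_ring
      _ = _ := by rw [h1, h4, h5]; noncomm_ring

theorem hermite {R : Type*} [Ring R] [IsDomain R] (hB : IsBezoutRing R) (n : ℕ) :
    ∀ α : Fin (n + 1) → R, ∃ (g : R) (V : Matrix (Fin (n + 1)) (Fin (n + 1)) R),
      IsUnit V ∧ ∀ j, α j = g * V 0 j := by
  induction n with
  | zero =>
    intro α
    exact ⟨α 0, 1, isUnit_one, fun j => by 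
      have hj : j = 0 := Fin.ext (by omega)
      rw [hj]; simp⟩
  | succ n ih =>
    intro α
    obtain ⟨g, V, hV, hα⟩ := ih (fun j => α j.succ)
    have H : ∃ h a b x y : R, α 0 = h * a ∧ g = h * b ∧ a * x + b * y = 1 := by
      obtain ⟨x, y, ⟨a, ha⟩, ⟨b, hb⟩⟩ := bez2 hB (α 0) g
      set d := α 0 * x + g * y with hd
      by_cases d0 : d = 0
      · rw [d0, zero_mul] at ha hb
        exact ⟨0, 1, 0, 1, 0, by simpa using ha, by simpa using hb, by simp⟩
      · refine ⟨d, a, b, x, y, ha, hb, ?_⟩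
        apply mul_left_cancel₀ d0
        rw [mul_add, ← mul_assoc, ← mul_assoc, ← ha, ← hb, mul_one]
    obtain ⟨h, a, b, x, y, ha, hb, hxy⟩ := H
    obtain ⟨c, d, hu⟩ := complete2 hB hxy n
    refine ⟨h, blk2 n a b c d * blk 1 V, hu.mul (blk_unit isUnit_one hV), fun j => ?_⟩
    refine Fin.cases ?_ (fun j => ?_) j
    · simp [Matrix.mul_apply, blk, blk2, Fin.sum_univ_succ, ha]
    · simp [Matrix.mul_apply, blk, blk2, Fin.sum_univ_succ, hα, hb, mul_assoc]

/-- A unimodular row and a column dual to it sit in mutually inverse matrices. -/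
theorem complete {R : Type*} [Ring R] [IsDomain R] (hB : IsBezoutRing R) {n : ℕ}
    (α q : Fin (n + 1) → R) (h : ∑ j, α j * q j = 1) :
    ∃ U V : Matrix (Fin (n + 1)) (Fin (n + 1)) R, U * V = 1 ∧ V * U = 1 ∧
      (∀ j, V 0 j = α j) ∧ (∀ j, U j 0 = q j) := by
  obtain ⟨g, V, hV, hα⟩ := hermite hB n α
  have hg : IsUnit g := by
    have : g * ∑ j, V 0 j * q j = 1 := by
      rw [Finset.mul_sum, ← h]; simp only [hα, mul_assoc]
    exact IsUnit.of_mul_eq_one _ this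
  have hW : IsUnit (blk g 1 * V) := (blk_unit hg isUnit_one).mul hV
  have hW0 : ∀ j, (blk g (1 : Matrix (Fin n) (Fin n) R) * V) 0 j = α j := by
    intro j
    simp [Matrix.mul_apply, blk, Fin.sum_univ_succ, hα]
  obtain ⟨W, hWe⟩ := hW
  rw [← hWe] at hW0
  let w : Fin (n + 1) → R := (W : Matrix _ _ R).mulVec q
  have hw0 : w 0 = 1 := by
    rw [← h]; simp only [w, Matrix.mulVec, dotProduct, hW0]
  let T : (Fin n → R) → Matrix (Fin (n + 1)) (Fin (n + 1)) R := fun f =>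
    Matrix.of (Fin.cons (Fin.cons 1 0) (fun i => Fin.cons (f i) ((1 : Matrix (Fin n) (Fin n) R) i)))
  have hT : ∀ f f', T f * T f' = T (f + f') := by
    intro f f'
    ext i j
    refine Fin.cases ?_ (fun i => ?_) i <;> refine Fin.cases ?_ (fun j => ?_) j <;>
      simp [T, Matrix.mul_apply, Fin.sum_univ_succ, Matrix.one_apply]
  have hT0 : T 0 = 1 := by
    rw [← blk_one]; rfl
  let f : Fin n → R := fun i => w i.succ
  have hT1 : T f * T (-f) = 1 := by rw [hT, add_neg_cancel, hT0]
  have hT2 : T (-f) * T f = 1 := by rw [hT, neg_add_cancel, hT0]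
  refine ⟨(↑W⁻¹ : Matrix (Fin (n + 1)) (Fin (n + 1)) R) * T f, T (-f) * (W : Matrix _ _ R), ?_, ?_, ?_, ?_⟩
  · rw [mul_assoc, ← mul_assoc (T f), hT1, one_mul, Units.inv_mul]
  · rw [mul_assoc, Units.mul_inv_cancel_left, hT2]
  · intro j
    simp [Matrix.mul_apply, Fin.sum_univ_succ, T, ← hW0]
  · intro j
    have h1 : (fun i => T f i 0) = w := by
      funext i
      refine Fin.cases ?_ (fun i => ?_) i
      · simp [T, hw0]
      · simp [T, f]
    have h2 : ((↑W⁻¹ : Matrix (Fin (n + 1)) (Fin (n + 1)) R) * T f) j 0 = (↑W⁻¹ : Matrix (Fin (n + 1)) (Fin (n + 1)) R).mulVec w j := by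
      rw [← h1]; rfl
    rw [h2]
    simp only [w, Matrix.mulVec_mulVec, Units.inv_mul, Matrix.one_mulVec]

theorem reduce {R : Type*} [Ring R] [IsDomain R] (hB : IsBezoutRing R) (hD : IsDuoRing R)
    (hLS : ∀ a b : R, (∃ x y : R, a * x + b * y = 1) →
      ∃ y : R, HasStableRange1 (QuotBy (a + b * y))) {m n : ℕ}
    (A : Matrix (Fin (m + 1)) (Fin (n + 1)) R) (hA : A ≠ 0) :
    ∃ (P : Matrix (Fin (m + 1)) (Fin (m + 1)) R) (Q : Matrix (Fin (n + 1)) (Fin (n + 1)) R)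
      (d : R) (E : Matrix (Fin m) (Fin n) R), IsUnit P ∧ IsUnit Q ∧ P * A * Q = blk d E ∧
      ∀ i j, d ∣ E i j := by
  obtain ⟨p, q, hpq⟩ := reach hB hD hLS (n + 1) (m + 1) A
  set d := ∑ j, (∑ i, p i * A i j) * q j with hd
  have d0 : d ≠ 0 := by
    intro h0; apply hA; ext i j
    have := hpq i j
    rw [h0, zero_dvd_iff] at this
    simpa using this
  have hα : ∀ j, ∃ w, (∑ i, p i * A i j) = d * w := fun j => dvd_vecMul hD hpq p j
  choose α hα using hα
  have hβ : ∀ i, ∃ w, (∑ j, A i j * q j) = w * d := fun i =>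
    dvd_left hD (Finset.dvd_sum fun j _ => (hpq i j).mul_right _)
  choose β hβ using hβ
  have hαq : ∑ j, α j * q j = 1 := by
    apply mul_left_cancel₀ d0
    rw [Finset.mul_sum, mul_one]
    conv_rhs => rw [hd]
    simp only [hα, mul_assoc]
  have hpβ : ∑ i, p i * β i = 1 := by
    apply mul_right_cancel₀ d0
    rw [Finset.sum_mul, one_mul]
    conv_rhs => rw [hd]
    simp only [mul_assoc, ← hβ, Finset.mul_sum, Finset.sum_mul]
    rw [Finset.sum_comm]
  obtain ⟨Q, Q', hQ1, hQ2, hQα, hQq⟩ := complete hB α q hαq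
  obtain ⟨P', P, hP1, hP2, hPp, hPβ⟩ := complete hB p β hpβ
  refine ⟨P, Q, d, fun i j => (P * A * Q) i.succ j.succ, ⟨⟨P, P', hP2, hP1⟩, rfl⟩,
    ⟨⟨Q, Q', hQ1, hQ2⟩, rfl⟩, ?_, ?_⟩
  · have row : ∀ j, (P * A * Q) 0 j = d * (1 : Matrix (Fin (n+1)) (Fin (n+1)) R) 0 j := by
      intro j
      rw [← hQ2, Matrix.mul_apply, Matrix.mul_apply, Finset.mul_sum]
      refine Finset.sum_congr rfl fun k _ => ?_
      rw [hQα, ← mul_assoc, ← hα, Matrix.mul_apply]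
      simp only [hPp]
    have col : ∀ i, (P * A * Q) i 0 = (1 : Matrix (Fin (m+1)) (Fin (m+1)) R) i 0 * d := by
      intro i
      rw [← hP2, Matrix.mul_assoc, Matrix.mul_apply, Matrix.mul_apply, Finset.sum_mul]
      refine Finset.sum_congr rfl fun k _ => ?_
      rw [hPβ, mul_assoc, ← hβ, Matrix.mul_apply]
      simp only [hQq]
    ext i j
    refine Fin.cases ?_ (fun i => ?_) i
    · rw [row]
      refine Fin.cases ?_ (fun j => ?_) j
      · simp [blk]
      · simp [blk, Matrix.one_apply, (Fin.succ_ne_zero _).symm]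
    · refine Fin.cases ?_ (fun j => ?_) j
      · rw [col]; simp [blk, Matrix.one_apply, Fin.succ_ne_zero]
      · simp [blk]
  · intro i j
    have : ∀ i j, d ∣ (P * A) i j := fun i j => dvd_vecMul hD hpq (P i) j
    change d ∣ (P * A * Q) i.succ j.succ
    rw [Matrix.mul_apply]
    exact Finset.dvd_sum fun k _ => (this _ k).mul_right _

end EDR

/-- Every locally stable Bézout duo-domain is an elementary divisor ring. -/
theorem stmt9 (R : Type*) [Ring R] [IsDomain R]
    (hB : IsBezoutRing R) (hD : IsDuoRing R)
    (hLS : ∀ a b : R, (∃ x y : R, a * x + b * y = 1) →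
      ∃ y : R, HasStableRange1 (QuotBy (a + b * y))) :
    ElementaryDivisorRing R := by
  intro m
  induction m with
  | zero =>
    intro n A
    exact ⟨1, 1, isUnit_one, isUnit_one, fun i => i.elim0, fun i => i.elim0⟩
  | succ m ih =>
    intro n A
    by_cases hA : A = 0
    · subst hA
      exact ⟨1, 1, isUnit_one, isUnit_one, fun i j _ => by simp,
        fun i j i' j' _ _ _ x y => ⟨⟨0, by simp⟩, ⟨0, by simp⟩⟩⟩
    cases n with
    | zero => exact ⟨1, 1, isUnit_one, isUnit_one, fun i j => j.elim0, fun i j => j.elim0⟩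
    | succ n =>
      obtain ⟨P, Q, d, E, hP, hQ, hE, hdE⟩ := EDR.reduce hB hD hLS A hA
      obtain ⟨P', Q', hP', hQ', h1, h2⟩ := ih n E
      have key : (EDR.blk 1 P' * P) * A * (Q * EDR.blk 1 Q') = EDR.blk d (P' * E * Q') := by
        calc _ = EDR.blk 1 P' * (P * A * Q) * EDR.blk 1 Q' := by simp only [Matrix.mul_assoc]
          _ = _ := by rw [hE, EDR.blk_mul, EDR.blk_mul, one_mul, mul_one]
      have hdD : ∀ i j, d ∣ (P' * E * Q') i j := by
        intro i j
        rw [Matrix.mul_apply]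
        exact Finset.dvd_sum fun k _ => (EDR.dvd_vecMul hD hdE (P' i) k).mul_right _
      refine ⟨EDR.blk 1 P' * P, Q * EDR.blk 1 Q', (EDR.blk_unit isUnit_one hP').mul hP,
        hQ.mul (EDR.blk_unit isUnit_one hQ'), ?_, ?_⟩
      · rw [key]
        intro i j
        refine Fin.cases ?_ (fun i => ?_) i <;> refine Fin.cases ?_ (fun j => ?_) j
        · simp
        · simp [EDR.blk]
        · simp [EDR.blk]
        · intro hij
          have := h1 i j (by simpa using hij)
          simpa [EDR.blk] using this
      · rw [key]
        intro i j i' j'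
        refine Fin.cases ?_ (fun i' => ?_) i'
        · intro _ _ h; simp at h
        refine Fin.cases ?_ (fun j' => ?_) j'
        · intro _ h; simp at h
        refine Fin.cases ?_ (fun i => ?_) i <;> refine Fin.cases ?_ (fun j => ?_) j
        · intro _ _ _ x y
          have h3' := EDR.dvd_mul3 hD (hdD i' j') x y
          have h4 := EDR.dvd_left hD h3'
          have h3 : ∃ u, x * (P' * E * Q') i' j' * y = d * u := h3'
          simpa [EDR.blk] using And.intro h3 h4
        · intro h; simp at h
        · intro h; simp at h
        · intro ha hb hc x y
          have := h2 i j i' j' (by simpa using ha) (by simpa using hb) (by simpa using hc) x y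
          simpa [EDR.blk] using this
end

section
/- Let R be a Bézout duo-domain. If R/aR has stable range 1 for every nonzero a ∈ R, then R is an elementary divisor ring. -/
namespace BDuo

/-- Elementwise form of the hypotheses. -/
structure Good (R : Type*) [Ring R] : Prop where
  d1 : ∀ a r : R, ∃ s, r * a = a * s
  d2 : ∀ a r : R, ∃ s, a * r = s * a
  bez : ∀ a b : R, ∃ d x y a' b' : R, a * x + b * y = d ∧ a = d * a' ∧ b = d * b'
  sr : ∀ a b c x y z : R, c ≠ 0 → a * x + b * y + c * z = 1 →
    ∃ t u v, (a + b * t) * u + c * v = 1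

section alg
variable {R : Type*} [Ring R]

theorem good_of (hB : IsBezoutRing R) (hD : IsDuoRing R)
    (h : ∀ a : R, a ≠ 0 → HasStableRange1 (QuotBy a)) : Good R := by
  have d1 : ∀ a r : R, ∃ s, r * a = a * s := by
    intro a r
    have := hD.2 (Submodule.span Rᵐᵒᵖ {a}) a (Submodule.mem_span_singleton_self a) r
    obtain ⟨s, hs⟩ := Submodule.mem_span_singleton.1 this
    exact ⟨s.unop, by rw [← hs]; rfl⟩
  have d2 : ∀ a r : R, ∃ s, a * r = s * a := by
    intro a r
    have := hD.1 (Ideal.span {a}) a (Submodule.mem_span_singleton_self a) r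
    obtain ⟨s, hs⟩ := Submodule.mem_span_singleton.1 this
    exact ⟨s, by rw [← hs]; rfl⟩
  refine ⟨d1, d2, ?_, ?_⟩
  · intro a b
    obtain ⟨d, hd⟩ := hB.2 (Submodule.span Rᵐᵒᵖ {a, b})
      (Submodule.fg_span (Set.toFinite _))
    have h1 : d ∈ Submodule.span Rᵐᵒᵖ {a, b} := by
      rw [hd]; exact Submodule.mem_span_singleton_self d
    have h2 : a ∈ Submodule.span Rᵐᵒᵖ {d} := by
      rw [← hd]; exact Submodule.subset_span (by simp)
    have h3 : b ∈ Submodule.span Rᵐᵒᵖ {d} := by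
      rw [← hd]; exact Submodule.subset_span (by simp)
    obtain ⟨x, y, hxy⟩ := Submodule.mem_span_pair.1 h1
    obtain ⟨a', ha⟩ := Submodule.mem_span_singleton.1 h2
    obtain ⟨b', hb⟩ := Submodule.mem_span_singleton.1 h3
    exact ⟨d, x.unop, y.unop, a'.unop, b'.unop, by rw [← hxy]; rfl,
      by rw [← ha]; rfl, by rw [← hb]; rfl⟩
  · intro a b c x y z hc e
    have key : ∀ w : R, w ∈ TwoSidedIdeal.span {c} → ∃ v, w = c * v := by
      intro w hw
      let J : TwoSidedIdeal R := TwoSidedIdeal.mk' {w | ∃ v, w = c * v}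
        ⟨0, by simp⟩
        (by rintro _ _ ⟨p, rfl⟩ ⟨q, rfl⟩; exact ⟨p + q, by rw [mul_add]⟩)
        (by rintro _ ⟨p, rfl⟩; exact ⟨-p, by simp⟩)
        (by
          rintro r _ ⟨p, rfl⟩
          obtain ⟨s, hs⟩ := d1 c r
          exact ⟨s * p, by rw [← mul_assoc, hs, mul_assoc]⟩)
        (by rintro _ r ⟨p, rfl⟩; exact ⟨p * r, by rw [mul_assoc]⟩)
      have hle : TwoSidedIdeal.span {c} ≤ J := by
        rw [TwoSidedIdeal.span_le]
        rintro _ rfl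
        exact (TwoSidedIdeal.mem_mk' _ _ _ _ _ _ _).2 ⟨1, by simp⟩
      have hw' := hle hw
      rw [TwoSidedIdeal.mem_mk'] at hw'
      exact hw'
    let I := TwoSidedIdeal.span {c}
    let π : R →+* QuotBy c := I.ringCon.mk'
    have hπ : ∀ w, π w = 0 ↔ w ∈ I := by
      intro w
      rw [TwoSidedIdeal.mem_iff, ← map_zero π]
      exact RingCon.eq _
    have hπc : π c = 0 := (hπ c).2 (TwoSidedIdeal.subset_span rfl)
    obtain ⟨Y, hY⟩ := h c hc (π a) (π b) ⟨π x, π y, by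
      have := congrArg π e
      simpa [hπc] using this⟩
    obtain ⟨t, rfl⟩ := I.ringCon.mk'_surjective Y
    obtain ⟨U, hU⟩ := hY.exists_right_inv
    obtain ⟨u, rfl⟩ := I.ringCon.mk'_surjective U
    have : π (1 - (a + b * t) * u) = 0 := by
      rw [map_sub, map_mul, map_add, map_mul, map_one]
      exact sub_eq_zero.2 hU.symm
    obtain ⟨v, hv⟩ := key _ ((hπ _).1 this)
    exact ⟨t, u, v, by rw [← hv]; abel⟩

/-- explicit two by two reduction data: `(a,b) * [[p,q],[r,s]] = (d,0)`. -/
theorem red_col [IsDomain R] (G : Good R) (a b : R) :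
    ∃ d : R, ∃ T : (Matrix (Fin 2) (Fin 2) R)ˣ,
      a * T.1 0 0 + b * T.1 1 0 = d ∧ a * T.1 0 1 + b * T.1 1 1 = 0 := by
  by_cases hb : b = 0
  · exact ⟨a, 1, by simp [hb], by simp [hb]⟩
  obtain ⟨d, x, y, a, b, hd, rfl, rfl⟩ := G.bez a b
  have hd0 : d ≠ 0 := left_ne_zero_of_mul hb
  have hb0 : b ≠ 0 := right_ne_zero_of_mul hb
  have e : a * x + b * y = 1 := by
    apply mul_left_cancel₀ hd0
    rw [mul_add, ← mul_assoc, ← mul_assoc, hd, mul_one]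
  obtain ⟨a1, ha1⟩ := G.d1 b a
  obtain ⟨x', hx'⟩ := G.d2 a x
  obtain ⟨y', hy'⟩ := G.d2 b y
  have ker : ∀ u v, a * u + b * v = 0 → ∃ w, u = b * w ∧ v = -a1 * w := by
    intro u v huv
    obtain ⟨p, hp⟩ := G.d1 b x'
    obtain ⟨q, hq⟩ := G.d1 b y'
    have hu : u = b * (q * u - p * v) := by
      have h1 : u = (x' * a + y' * b) * u := by rw [← hx', ← hy', e, one_mul]
      have h2 : a * u = -(b * v) := eq_neg_of_add_eq_zero_left huv
      calc u = x' * (a * u) + y' * b * u := by rw [h1.symm.trans rfl |>.symm]; nth_rw 1 [h1]; noncomm_ring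
        _ = b * (q * u - p * v) := by
          rw [h2, hq, mul_neg, ← mul_assoc, hp]; noncomm_ring
    refine ⟨_, hu, ?_⟩
    set w := q * u - p * v
    rw [hu, ← mul_assoc, ha1, mul_assoc, ← mul_add] at huv
    have := (mul_eq_zero.1 huv).resolve_left hb0
    rw [neg_mul]; exact eq_neg_of_add_eq_zero_right this
  obtain ⟨w1, h11, h12⟩ := ker (1 - x * a) (-(y * a)) (by
    calc _ = a - (a * x + b * y) * a := by noncomm_ring
      _ = 0 := by rw [e]; simp)
  obtain ⟨w2, h21, h22⟩ := ker (-(x * b)) (1 - y * b) (by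
    calc _ = b - (a * x + b * y) * b := by noncomm_ring
      _ = 0 := by rw [e]; simp)
  have i1 : w1 * x + w2 * y = 0 := by
    apply mul_left_cancel₀ hb0
    calc b * (w1 * x + w2 * y) = (b * w1) * x + (b * w2) * y := by noncomm_ring
      _ = x - x * (a * x + b * y) := by rw [← h11, ← h21]; noncomm_ring
      _ = b * 0 := by rw [e]; simp
  have i2 : w1 * b + w2 * -a1 = 1 := by
    apply mul_left_cancel₀ hb0
    calc b * (w1 * b + w2 * -a1) = (b * w1) * b - (b * w2) * a1 := by noncomm_ring
      _ = b - x * (a * b - b * a1) := by rw [← h11, ← h21]; noncomm_ring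
      _ = b * 1 := by rw [ha1]; simp
  have i3 : a * b + b * -a1 = 0 := by rw [ha1]; simp
  refine ⟨d, ⟨!![x, b; y, -a1], !![a, b; w1, w2], ?_, ?_⟩, ?_, ?_⟩
  · rw [Matrix.mul_fin_two, Matrix.one_fin_two, ← h11, ← h21, ← h12, ← h22]
    simp
  · rw [Matrix.mul_fin_two, Matrix.one_fin_two, e, i1, i2, i3]
  · simpa [mul_assoc] using hd
  · have : d * (a * b + b * -a1) = 0 := by rw [i3, mul_zero]
    simpa [mul_add, mul_assoc] using this

theorem good_op [IsDomain R] (G : Good R) : Good Rᵐᵒᵖ where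
  d1 := fun a r => by
    obtain ⟨s, hs⟩ := G.d2 a.unop r.unop
    exact ⟨.op s, MulOpposite.unop_injective hs⟩
  d2 := fun a r => by
    obtain ⟨s, hs⟩ := G.d1 a.unop r.unop
    exact ⟨.op s, MulOpposite.unop_injective hs⟩
  bez := fun a b => by
    obtain ⟨d, x, y, a', b', h1, h2, h3⟩ := G.bez a.unop b.unop
    obtain ⟨x', hx⟩ := G.d2 a.unop x
    obtain ⟨y', hy⟩ := G.d2 b.unop y
    obtain ⟨a2, ha⟩ := G.d2 d a'
    obtain ⟨b2, hb⟩ := G.d2 d b'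
    exact ⟨.op d, .op x', .op y', .op a2, .op b2,
      MulOpposite.unop_injective (by rw [← h1, hx, hy]; rfl),
      MulOpposite.unop_injective (by rw [h2, ha]; rfl),
      MulOpposite.unop_injective (by rw [h3, hb]; rfl)⟩
  sr := fun a b c x y z hc e => by
    have e' := congrArg MulOpposite.unop e
    change x.unop * a.unop + y.unop * b.unop + z.unop * c.unop = 1 at e'
    obtain ⟨x', hx⟩ := G.d1 a.unop x.unop
    obtain ⟨y', hy⟩ := G.d1 b.unop y.unop
    obtain ⟨z', hz⟩ := G.d1 c.unop z.unop
    rw [hx, hy, hz] at e'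
    obtain ⟨t, u, v, h⟩ := G.sr _ _ _ _ _ _ (by simpa using hc) e'
    obtain ⟨t', ht⟩ := G.d2 b.unop t
    rw [ht] at h
    obtain ⟨u', hu⟩ := G.d2 (a.unop + t' * b.unop) u
    obtain ⟨v', hv⟩ := G.d2 c.unop v
    rw [hu, hv] at h
    exact ⟨.op t', .op u', .op v', MulOpposite.unop_injective h⟩

theorem red_row [IsDomain R] (G : Good R) (a b : R) :
    ∃ d : R, ∃ T : (Matrix (Fin 2) (Fin 2) R)ˣ,
      T.1 0 0 * a + T.1 0 1 * b = d ∧ T.1 1 0 * a + T.1 1 1 * b = 0 := by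
  obtain ⟨d, T, h1, h2⟩ := red_col (good_op G) (.op a) (.op b)
  have tr : ∀ A B : Matrix (Fin 2) (Fin 2) Rᵐᵒᵖ, A * B = 1 →
      (Matrix.of fun i j => (B j i).unop) * (Matrix.of fun i j => (A j i).unop) = 1 := by
    intro A B hAB
    ext i j
    have := congrArg MulOpposite.unop (congrFun (congrFun hAB j) i)
    rw [Matrix.mul_apply] at this ⊢
    simp only [Fin.sum_univ_two, Matrix.of_apply, MulOpposite.unop_add, MulOpposite.unop_mul] at this ⊢
    rw [this]
    fin_cases i <;> fin_cases j <;> simp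
  exact ⟨d.unop, ⟨_, _, tr _ _ T.inv_mul, tr _ _ T.mul_inv⟩,
    congrArg MulOpposite.unop h1, congrArg MulOpposite.unop h2⟩

/-- left divisibility -/
def Dv (d x : R) : Prop := ∃ u, x = d * u

theorem Dv.refl (d : R) : Dv d d := ⟨1, by simp⟩
theorem Dv.trans {a b c : R} : Dv a b → Dv b c → Dv a c := by
  rintro ⟨u, rfl⟩ ⟨v, rfl⟩; exact ⟨u * v, by rw [mul_assoc]⟩
theorem Dv.zero (d : R) : Dv d 0 := ⟨0, by simp⟩
theorem Dv.add {d x y : R} : Dv d x → Dv d y → Dv d (x + y) := by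
  rintro ⟨u, rfl⟩ ⟨v, rfl⟩; exact ⟨u + v, by rw [mul_add]⟩
theorem Dv.mulr {d x : R} (r : R) : Dv d x → Dv d (x * r) := by
  rintro ⟨u, rfl⟩; exact ⟨u * r, by rw [mul_assoc]⟩
theorem Dv.mull (G : Good R) {d x : R} (r : R) : Dv d x → Dv d (r * x) := by
  rintro ⟨u, rfl⟩
  obtain ⟨s, hs⟩ := G.d1 d r
  exact ⟨s * u, by rw [← mul_assoc, hs, mul_assoc]⟩
theorem Dv.sum {d : R} {ι : Type*} (s : Finset ι) (f : ι → R) (h : ∀ i ∈ s, Dv d (f i)) :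
    Dv d (∑ i ∈ s, f i) :=
  Finset.sum_induction f (Dv d) (fun _ _ => Dv.add) (Dv.zero d) h

theorem sr_gcd [IsDomain R] (G : Good R) (a b c : R) (hc : c ≠ 0) :
    ∃ t u v d : R, (a + t * b) * u + c * v = d ∧ Dv d a ∧ Dv d b ∧ Dv d c := by
  obtain ⟨g, x, y, a', b', hg, rfl, rfl⟩ := G.bez a b
  obtain ⟨d, p, q, g', c', hd, rfl, rfl⟩ := G.bez g c
  have hd0 : d ≠ 0 := left_ne_zero_of_mul hc
  have hc0 : c' ≠ 0 := right_ne_zero_of_mul hc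
  have e : (g' * a') * (x * p) + (g' * b') * (y * p) + c' * q = 1 := by
    apply mul_left_cancel₀ hd0
    calc _ = (d * g' * a' * x + d * g' * b' * y) * p + d * c' * q := by noncomm_ring
      _ = d * 1 := by rw [hg, hd, mul_one]
  obtain ⟨t, u, v, h⟩ := G.sr _ _ _ _ _ _ hc0 e
  obtain ⟨t', ht⟩ := G.d2 (d * g' * b') t
  refine ⟨t', u, v, d, ?_, ⟨g' * a', by noncomm_ring⟩, ⟨g' * b', by noncomm_ring⟩, ⟨c', rfl⟩⟩
  rw [← ht]
  calc _ = d * ((g' * a' + g' * b' * t) * u + c' * v) := by noncomm_ring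
    _ = d := by rw [h, mul_one]

end alg

section mat
open Matrix
variable {R : Type*} [Ring R]

theorem dv_mul_right {l m n : ℕ} {d : R} (A : Matrix (Fin l) (Fin m) R) (B : Matrix (Fin m) (Fin n) R)
    (i : Fin l) (h : ∀ j, Dv d (A i j)) (j) : Dv d ((A * B) i j) := by
  rw [mul_apply]; exact Dv.sum _ _ fun k _ => (h k).mulr _

theorem dv_mul_left (G : Good R) {l m n : ℕ} {d : R} (A : Matrix (Fin l) (Fin m) R)
    (B : Matrix (Fin m) (Fin n) R)
    (h : ∀ i j, Dv d (B i j)) (i j) : Dv d ((A * B) i j) := by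
  rw [mul_apply]; exact Dv.sum _ _ fun k _ => (h k j).mull G _

/-- embedding of a small matrix along `f`. -/
def emb {k n : ℕ} (f : Fin k → Fin n) (T : Matrix (Fin k) (Fin k) R) : Matrix (Fin n) (Fin n) R :=
  1 + (1 : Matrix (Fin n) (Fin n) R).submatrix id f * (T - 1) *
    (1 : Matrix (Fin n) (Fin n) R).submatrix f id

theorem VU {k n : ℕ} (f : Fin k → Fin n) (hf : f.Injective) :
    (1 : Matrix (Fin n) (Fin n) R).submatrix f id * (1 : Matrix (Fin n) (Fin n) R).submatrix id f
      = 1 := by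
  rw [← submatrix_mul _ _ f id f Function.bijective_id, one_mul, submatrix_one f hf]

theorem emb_mul {k n : ℕ} (f : Fin k → Fin n) (hf : f.Injective) (S T : Matrix (Fin k) (Fin k) R) :
    emb f S * emb f T = emb f (S * T) := by
  have h := VU (R := R) f hf
  unfold emb
  generalize (1 : Matrix (Fin n) (Fin n) R).submatrix f id = V at *
  generalize (1 : Matrix (Fin n) (Fin n) R).submatrix id f = U at *
  have : (U * (S - 1) * V) * (U * (T - 1) * V) = U * ((S - 1) * (T - 1)) * V := by
    calc _ = U * (S - 1) * (V * U) * (T - 1) * V := by simp only [Matrix.mul_assoc]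
      _ = _ := by rw [h, Matrix.mul_one]; simp only [Matrix.mul_assoc]
  rw [add_mul, mul_add, mul_add, this, one_mul, one_mul, mul_one]
  have e : S * T - 1 = (S - 1) + (T - 1) + (S - 1) * (T - 1) := by noncomm_ring
  rw [e, Matrix.mul_add, Matrix.mul_add, Matrix.add_mul, Matrix.add_mul]
  abel

theorem emb_unit {k n : ℕ} (f : Fin k → Fin n) (hf : f.Injective) {T : Matrix (Fin k) (Fin k) R}
    (hT : IsUnit T) : IsUnit (emb f T) := by
  obtain ⟨T, rfl⟩ := hT
  have h1 : emb f (1 : Matrix (Fin k) (Fin k) R) = 1 := by simp [emb]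
  exact ⟨⟨emb f T.1, emb f T⁻¹.1, by rw [emb_mul f hf, T.mul_inv, h1],
    by rw [emb_mul f hf, T.inv_mul, h1]⟩, rfl⟩

theorem emb_left {k n l : ℕ} (f : Fin k → Fin n) (hf : f.Injective) (T : Matrix (Fin k) (Fin k) R)
    (A : Matrix (Fin n) (Fin l) R) :
    (emb f T * A).submatrix f id = T * A.submatrix f id := by
  have hV : ∀ B : Matrix (Fin n) (Fin l) R,
      B.submatrix f id = (1 : Matrix (Fin n) (Fin n) R).submatrix f id * B := by
    intro B
    conv_lhs => rw [← Matrix.one_mul B, submatrix_mul _ _ f id id Function.bijective_id]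
    rfl
  rw [hV, hV, ← Matrix.mul_assoc, ← Matrix.mul_assoc]
  congr 1
  rw [emb, Matrix.mul_add, ← Matrix.mul_assoc, ← Matrix.mul_assoc, VU f hf, Matrix.one_mul,
    Matrix.mul_one, Matrix.sub_mul, Matrix.one_mul]
  abel

theorem emb_right {k n l : ℕ} (f : Fin k → Fin n) (hf : f.Injective) (T : Matrix (Fin k) (Fin k) R)
    (A : Matrix (Fin l) (Fin n) R) :
    (A * emb f T).submatrix id f = A.submatrix id f * T := by
  have hV : ∀ B : Matrix (Fin l) (Fin n) R,
      B.submatrix id f = B * (1 : Matrix (Fin n) (Fin n) R).submatrix id f := by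
    intro B
    conv_lhs => rw [← Matrix.mul_one B, submatrix_mul _ _ id id f Function.bijective_id]
    rfl
  rw [hV, hV, Matrix.mul_assoc, Matrix.mul_assoc]
  congr 1
  rw [emb, Matrix.add_mul, Matrix.mul_assoc, VU f hf, Matrix.mul_one,
    Matrix.one_mul, Matrix.mul_sub, Matrix.mul_one]
  abel

theorem emb_left_off {k n l : ℕ} (f : Fin k → Fin n) (T : Matrix (Fin k) (Fin k) R)
    (A : Matrix (Fin n) (Fin l) R) (i : Fin n) (hi : ∀ x, f x ≠ i) (j) :
    (emb f T * A) i j = A i j := by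
  rw [emb, Matrix.add_mul, Matrix.one_mul, Matrix.mul_assoc, Matrix.mul_assoc, Matrix.add_apply,
    Matrix.mul_apply, Finset.sum_eq_zero, add_zero]
  intro x _
  rw [submatrix_apply, id, one_apply_ne (hi x).symm, zero_mul]

theorem emb_right_off {k n l : ℕ} (f : Fin k → Fin n) (T : Matrix (Fin k) (Fin k) R)
    (A : Matrix (Fin l) (Fin n) R) (j : Fin n) (hj : ∀ x, f x ≠ j) (i) :
    (A * emb f T) i j = A i j := by
  rw [emb, Matrix.mul_add, Matrix.mul_one, ← Matrix.mul_assoc, Matrix.add_apply,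
    Matrix.mul_apply, Finset.sum_eq_zero, add_zero]
  intro x _
  rw [submatrix_apply, id, one_apply_ne (hj x), mul_zero]

theorem inj01 {n : ℕ} : Function.Injective (![0, 1] : Fin 2 → Fin (n + 2)) := by
  intro i j h
  fin_cases i <;> fin_cases j <;> simp_all

variable [IsDomain R]

theorem row_red (G : Good R) {m : ℕ} (n : ℕ) (A : Matrix (Fin m) (Fin (n + 1)) R) (i : Fin m) :
    ∃ Q : Matrix (Fin (n + 1)) (Fin (n + 1)) R, IsUnit Q ∧ ∀ j, j ≠ 0 → (A * Q) i j = 0 := by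
  induction n with
  | zero => exact ⟨1, isUnit_one, fun j hj => absurd (Fin.fin_one_eq_zero j) hj⟩
  | succ n ih =>
    obtain ⟨Q, hQ, h⟩ := ih (A.submatrix id Fin.succ)
    have hB := emb_right Fin.succ (Fin.succ_injective _) Q A
    have uB := emb_unit Fin.succ (Fin.succ_injective _) hQ
    generalize emb Fin.succ Q = E at *
    obtain ⟨d, T, h1, h2⟩ := red_col G ((A * E) i 0) ((A * E) i 1)
    have hC := emb_right ![0, 1] inj01 T.1 (A * E)
    have hoff := emb_right_off ![0, 1] T.1 (A * E)
    refine ⟨E * emb ![0, 1] T.1, uB.mul (emb_unit _ inj01 T.isUnit), fun j hj => ?_⟩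
    rw [← Matrix.mul_assoc]
    by_cases hj1 : j = 1
    · subst hj1
      have := congrFun (congrFun hC i) 1
      rw [mul_apply, Fin.sum_univ_two] at this
      exact this.trans h2
    · rw [hoff]
      · obtain ⟨j, rfl⟩ := Fin.exists_succ_eq.2 hj
        have := congrFun (congrFun hB i) j
        rw [submatrix_apply] at this
        exact this.trans (h j (by rintro rfl; exact hj1 rfl))
      · intro x
        fin_cases x
        · exact hj.symm
        · exact fun h => hj1 h.symm

/-- the row is divisible by the corner after reduction -/
theorem dv_of_row {m n : ℕ} (A : Matrix (Fin m) (Fin (n + 1)) R)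
    {Q : Matrix (Fin (n + 1)) (Fin (n + 1)) R} (hQ : IsUnit Q) (i : Fin m)
    (h : ∀ j, j ≠ 0 → (A * Q) i j = 0) (j) : Dv ((A * Q) i 0) (A i j) := by
  obtain ⟨Q, rfl⟩ := hQ
  have e : A = (A * Q.1) * Q⁻¹.1 := by rw [Matrix.mul_assoc, Q.mul_inv, Matrix.mul_one]
  have := dv_mul_right (A * Q.1) Q⁻¹.1 i (d := (A * Q.1) i 0) (fun j => by
    by_cases hj : j = 0
    · subst hj; exact Dv.refl _
    · rw [h j hj]; exact Dv.zero _) j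
  rwa [← e] at this

/-- one-sided column divisibility from a two by two row reduction -/
theorem dv_red_row (G : Good R) (a b d : R) (T : (Matrix (Fin 2) (Fin 2) R)ˣ)
    (h1 : T.1 0 0 * a + T.1 0 1 * b = d) (h2 : T.1 1 0 * a + T.1 1 1 * b = 0) :
    Dv d a ∧ Dv d b := by
  have e : !![a; b] = T⁻¹.1 * !![d; 0] := by
    have : T.1 * !![a; b] = !![d; 0] := by
      ext i j
      fin_cases i <;> fin_cases j <;> simp [mul_apply, h1, h2]
    rw [← this, ← Matrix.mul_assoc, T.inv_mul, Matrix.one_mul]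
  have hd := dv_mul_left G T⁻¹.1 !![d; 0] (d := d) (by
    intro i j
    fin_cases i <;> fin_cases j
    · exact Dv.refl _
    · exact Dv.zero _)
  rw [← e] at hd
  exact ⟨hd 0 0, hd 1 0⟩

theorem corner (G : Good R) (n m : ℕ) (A : Matrix (Fin (m + 1)) (Fin (n + 1)) R) :
    ∃ (P : Matrix (Fin (m + 1)) (Fin (m + 1)) R) (Q : Matrix (Fin (n + 1)) (Fin (n + 1)) R), IsUnit P ∧ IsUnit Q ∧
      ∀ i j, Dv ((P * A * Q) 0 0) ((P * A * Q) i j) := by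
  induction m with
  | zero =>
    obtain ⟨Q, hQ, h⟩ := row_red G n A 0
    refine ⟨1, Q, isUnit_one, hQ, fun i j => ?_⟩
    rw [Matrix.one_mul, Fin.fin_one_eq_zero i]
    by_cases hj : j = 0
    · subst hj; exact Dv.refl _
    · rw [h j hj]; exact Dv.zero _
  | succ m ih =>
    -- it suffices to treat an equivalent matrix
    suffices H : ∀ C : Matrix (Fin (m + 2)) (Fin (n + 1)) R,
        (∀ j, j ≠ 0 → C 1 j = 0) → (∀ i j, i ≠ 0 → Dv (C 1 0) (C i j)) →
        ∃ (P : Matrix (Fin (m + 2)) (Fin (m + 2)) R) (Q : Matrix (Fin (n + 1)) (Fin (n + 1)) R), IsUnit P ∧ IsUnit Q ∧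
          ∀ i j, Dv ((P * C * Q) 0 0) ((P * C * Q) i j) by
      obtain ⟨P, Q, hP, hQ, h⟩ := ih (A.submatrix Fin.succ id)
      have hE := emb_left Fin.succ (Fin.succ_injective _) P A
      have uE := emb_unit Fin.succ (Fin.succ_injective _) hP
      generalize emb Fin.succ P = E at *
      have hlow : ∀ i j, (E * A * Q) (Fin.succ i) j = (P * A.submatrix Fin.succ id * Q) i j := by
        intro i j
        rw [← hE]; rfl
      obtain ⟨Q', hQ', h'⟩ := row_red G n (E * A * Q) 1
      have hd1 := dv_of_row _ hQ' 1 h'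
      obtain ⟨P2, Q2, hP2, hQ2, h2⟩ := H (E * A * Q * Q') h' (by
        intro i j hi
        refine dv_mul_right _ _ _ (fun j => (hd1 0).trans ?_) _
        obtain ⟨i, rfl⟩ := Fin.exists_succ_eq.2 hi
        have := h i j
        rw [← hlow, ← hlow] at this
        exact this)
      refine ⟨P2 * E, Q * Q' * Q2, hP2.mul uE, (hQ.mul hQ').mul hQ2, ?_⟩
      have e : P2 * E * A * (Q * Q' * Q2) = P2 * (E * A * Q * Q') * Q2 := by
        simp only [Matrix.mul_assoc]
      rw [e]; exact h2
    intro C hz hdv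
    -- finishing when the first row vanishes off the corner
    have fin1 : ∀ C : Matrix (Fin (m + 2)) (Fin (n + 1)) R,
        (∀ j, j ≠ 0 → C 0 j = 0) → (∀ i j, i ≠ 0 → Dv (C 1 0) (C i j)) →
        ∃ (P : Matrix (Fin (m + 2)) (Fin (m + 2)) R) (Q : Matrix (Fin (n + 1)) (Fin (n + 1)) R), IsUnit P ∧ IsUnit Q ∧
          ∀ i j, Dv ((P * C * Q) 0 0) ((P * C * Q) i j) := by
      intro C hz0 hdv
      obtain ⟨d, T, h1, h2⟩ := red_row G (C 0 0) (C 1 0)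
      have hd := dv_red_row G _ _ _ _ h1 h2
      have hL := emb_left ![0, 1] inj01 T.1 C
      have h00 : ((emb ![0, 1] T.1 : Matrix (Fin (m + 2)) (Fin (m + 2)) R) * C) 0 0 = d := by
        have := congrFun (congrFun hL 0) 0
        rw [mul_apply, Fin.sum_univ_two] at this
        exact this.trans h1
      refine ⟨emb ![0, 1] T.1, 1, emb_unit _ inj01 T.isUnit, isUnit_one, ?_⟩
      rw [Matrix.mul_one, h00]
      refine dv_mul_left G _ _ fun i j => ?_
      by_cases hi : i = 0
      · subst hi
        by_cases hj : j = 0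
        · subst hj; exact hd.1
        · rw [hz0 j hj]; exact Dv.zero _
      · exact hd.2.trans (hdv i j hi)
    cases n with
    | zero => exact fin1 C (fun j hj => absurd (Fin.fin_one_eq_zero j) hj) hdv
    | succ n =>
      obtain ⟨Q, hQ, h⟩ := row_red G n (C.submatrix id Fin.succ) 0
      have hE := emb_right Fin.succ (Fin.succ_injective _) Q C
      have hoff := emb_right_off Fin.succ Q C 0 (fun x => Fin.succ_ne_zero x)
      have uE := emb_unit Fin.succ (Fin.succ_injective _) hQ
      generalize emb Fin.succ Q = E at *
      suffices H : ∃ (P : Matrix (Fin (m + 2)) (Fin (m + 2)) R) (Q : Matrix (Fin (n + 2)) (Fin (n + 2)) R), IsUnit P ∧ IsUnit Q ∧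
          ∀ i j, Dv ((P * (C * E) * Q) 0 0) ((P * (C * E) * Q) i j) by
        obtain ⟨P2, Q2, hP2, hQ2, h2⟩ := H
        refine ⟨P2, E * Q2, hP2, uE.mul hQ2, ?_⟩
        have e : P2 * C * (E * Q2) = P2 * (C * E) * Q2 := by simp only [Matrix.mul_assoc]
        rw [e]; exact h2
      have hz1 : ∀ j, j ≠ 0 → (C * E) 1 j = 0 := by
        intro j hj
        obtain ⟨j, rfl⟩ := Fin.exists_succ_eq.2 hj
        have := congrFun (congrFun hE 1) j
        rw [mul_apply] at this
        refine this.trans (Finset.sum_eq_zero fun x _ => ?_)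
        rw [submatrix_apply, id, hz _ (Fin.succ_ne_zero x), zero_mul]
      have hz0 : ∀ j, j ≠ 0 → j ≠ 1 → (C * E) 0 j = 0 := by
        intro j hj hj1
        obtain ⟨j, rfl⟩ := Fin.exists_succ_eq.2 hj
        have := congrFun (congrFun hE 0) j
        rw [submatrix_apply] at this
        exact this.trans (h j (by rintro rfl; exact hj1 rfl))
      have hdv' : ∀ i j, i ≠ 0 → Dv ((C * E) 1 0) ((C * E) i j) := by
        intro i j hi
        rw [hoff]
        exact dv_mul_right _ _ _ (fun j => hdv i j hi) _
      generalize C * E = B at *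
      by_cases hs : B 0 1 = 0
      · refine fin1 B (fun j hj => ?_) hdv'
        by_cases hj1 : j = 1
        · subst hj1; exact hs
        · exact hz0 j hj hj1
      · obtain ⟨t, u, v, d, hd, da, db, dc⟩ := sr_gcd G (B 0 0) (B 1 0) (B 0 1) hs
        let S : (Matrix (Fin 2) (Fin 2) R)ˣ := ⟨!![1, t; 0, 1], !![1, -t; 0, 1],
          by rw [Matrix.mul_fin_two, Matrix.one_fin_two]; simp,
          by rw [Matrix.mul_fin_two, Matrix.one_fin_two]; simp⟩
        have hL := emb_left ![0, 1] inj01 S.1 B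
        have uL := emb_unit (n := m + 2) ![0, 1] inj01 S.isUnit
        generalize (emb ![0, 1] S.1 : Matrix (Fin (m + 2)) (Fin (m + 2)) R) = L at *
        have hLB : ∀ j, (L * B) 0 j = B 0 j + t * B 1 j := by
          intro j
          have := congrFun (congrFun hL 0) j
          rw [mul_apply, Fin.sum_univ_two] at this
          refine this.trans ?_
          simp [S]
        obtain ⟨Q2, hQ2, h2⟩ := row_red G _ (L * B) 0
        have hd2 := dv_of_row _ hQ2 0 h2
        refine ⟨L, Q2, uL, hQ2, ?_⟩
        set e := (L * B * Q2) 0 0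
        have ed : Dv e d := by
          rw [← hd]
          refine ((hLB 0 ▸ hd2 0).mulr _).add (Dv.mulr _ ?_)
          have := hd2 1
          rwa [hLB, hz1 1 (by simp), mul_zero, add_zero] at this
        intro i j
        refine dv_mul_right _ _ _ (fun j => ?_) _
        refine dv_mul_left G _ _ (fun i j => ?_) _ _
        by_cases hi : i = 0
        · subst hi
          by_cases hj : j = 0
          · subst hj; exact ed.trans da
          by_cases hj1 : j = 1
          · subst hj1; exact ed.trans dc
          · rw [hz0 j hj hj1]; exact Dv.zero _
        · exact (ed.trans db).trans (hdv' i j hi)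

theorem clear_col (G : Good R) (n m : ℕ) (C : Matrix (Fin (m + 1)) (Fin (n + 1)) R)
    (hz : ∀ j, j ≠ 0 → C 0 j = 0) (hd : ∀ i, Dv (C 0 0) (C i 0)) :
    ∃ P : Matrix (Fin (m + 1)) (Fin (m + 1)) R, IsUnit P ∧ (P * C) 0 0 = C 0 0 ∧ (∀ j, j ≠ 0 → (P * C) 0 j = 0) ∧
      ∀ i, i ≠ 0 → (P * C) i 0 = 0 := by
  have hd' : ∀ i, ∃ w, C i 0 = w * C 0 0 := by
    intro i
    obtain ⟨u, hu⟩ := hd i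
    obtain ⟨w, hw⟩ := G.d2 (C 0 0) u
    exact ⟨w, hu.trans hw⟩
  choose w hw using hd'
  let N : Matrix (Fin (m + 1)) (Fin (m + 1)) R :=
    Matrix.of fun i j => if i = 0 then 0 else if j = 0 then - w i else 0
  have hN : ∀ {l : ℕ} (B : Matrix (Fin (m + 1)) (Fin l) R) i j,
      (N * B) i j = if i = 0 then 0 else - w i * B 0 j := by
    intro l B i j
    rw [mul_apply]
    by_cases hi : i = 0
    · simp [N, hi]
    · simp [N, hi]
  have hNN : N * N = 0 := by
    ext i j
    rw [hN]
    simp [N]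
  have hP : ∀ i j, ((1 + N : Matrix (Fin (m + 1)) (Fin (m + 1)) R) * C) i j = C i j + if i = 0 then 0 else - w i * C 0 j := by
    intro i j
    rw [Matrix.add_mul, Matrix.one_mul, Matrix.add_apply, hN]
  refine ⟨1 + N, ⟨⟨1 + N, 1 - N, ?_, ?_⟩, rfl⟩, ?_, ?_, ?_⟩
  · rw [add_mul, mul_sub, mul_sub, hNN]; simp
  · rw [sub_mul, mul_add, mul_add, hNN]; simp
  · simp [hP]
  · intro j hj; simp [hP, hz j hj]
  · intro i hi
    rw [hP, if_neg hi, hw i]; simp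

theorem diag (G : Good R) (m : ℕ) : ∀ (n : ℕ) (A : Matrix (Fin m) (Fin n) R),
    ∃ (P : Matrix (Fin m) (Fin m) R) (Q : Matrix (Fin n) (Fin n) R),
    IsUnit P ∧ IsUnit Q ∧
    (∀ (i : Fin m) (j : Fin n), (i : ℕ) ≠ (j : ℕ) → (P * A * Q) i j = 0) ∧
    (∀ (i : Fin m) (j : Fin n) (i' : Fin m) (j' : Fin n),
      (i : ℕ) = (j : ℕ) → (i' : ℕ) = (j' : ℕ) → (i' : ℕ) = (i : ℕ) + 1 →
      Dv ((P * A * Q) i j) ((P * A * Q) i' j')) := by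
  induction m with
  | zero => exact fun n A => ⟨1, 1, isUnit_one, isUnit_one, fun i => i.elim0, fun i => i.elim0⟩
  | succ m ih =>
    intro n A
    cases n with
    | zero => exact ⟨1, 1, isUnit_one, isUnit_one, fun _ i => i.elim0, fun _ i => i.elim0⟩
    | succ n =>
      obtain ⟨P1, Q1, hP1, hQ1, h1⟩ := corner G n m A
      obtain ⟨Q2, hQ2, h2⟩ := row_red G n (P1 * A * Q1) 0
      have hd2 := dv_of_row _ hQ2 0 h2 0
      have h3 : ∀ i j, Dv ((P1 * A * Q1 * Q2) 0 0) ((P1 * A * Q1 * Q2) i j) :=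
        fun i j => dv_mul_right _ _ _ (fun j => hd2.trans (h1 i j)) _
      obtain ⟨P2, hP2, c0, c1, c2⟩ := clear_col G n m _ h2 (fun i => h3 i 0)
      have h4 : ∀ i j, Dv ((P2 * (P1 * A * Q1 * Q2)) 0 0) ((P2 * (P1 * A * Q1 * Q2)) i j) := by
        rw [c0]; exact dv_mul_left G _ _ h3
      clear c0
      have eC : P2 * (P1 * A * Q1 * Q2) = (P2 * P1) * A * (Q1 * Q2) := by
        simp only [Matrix.mul_assoc]
      have uP := hP2.mul hP1
      have uQ := hQ1.mul hQ2
      rw [eC] at c1 c2 h4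
      clear eC
      generalize P2 * P1 = P3 at *
      generalize Q1 * Q2 = Q3 at *
      obtain ⟨P, Q, hP, hQ, k1, k2⟩ := ih n ((P3 * A * Q3).submatrix Fin.succ Fin.succ)
      refine ⟨emb Fin.succ P * P3, Q3 * emb Fin.succ Q,
        (emb_unit _ (Fin.succ_injective _) hP).mul uP,
        uQ.mul (emb_unit _ (Fin.succ_injective _) hQ), ?_⟩
      have e : emb Fin.succ P * P3 * A * (Q3 * emb Fin.succ Q)
          = emb Fin.succ P * (P3 * A * Q3) * emb Fin.succ Q := by
        simp only [Matrix.mul_assoc]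
      rw [e]
      generalize P3 * A * Q3 = C at *
      have a1 := emb_left Fin.succ (Fin.succ_injective _) P C
      have a2 := emb_left_off Fin.succ P C 0 (fun x => Fin.succ_ne_zero x)
      generalize emb Fin.succ P * C = D at *
      have b1 := emb_right Fin.succ (Fin.succ_injective _) Q D
      have b2 := emb_right_off Fin.succ Q D 0 (fun x => Fin.succ_ne_zero x)
      have f00 : (D * emb Fin.succ Q) 0 0 = C 0 0 := by rw [b2, a2]
      have f0s : ∀ j : Fin n, (D * emb Fin.succ Q) 0 j.succ = 0 := by
        intro j
        have := congrFun (congrFun b1 0) j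
        rw [mul_apply] at this
        refine this.trans (Finset.sum_eq_zero fun x _ => ?_)
        rw [submatrix_apply, id, a2, c1 _ (Fin.succ_ne_zero x), zero_mul]
      have fs0 : ∀ i : Fin m, (D * emb Fin.succ Q) i.succ 0 = 0 := by
        intro i
        rw [b2]
        have := congrFun (congrFun a1 i) 0
        rw [mul_apply] at this
        refine this.trans (Finset.sum_eq_zero fun x _ => ?_)
        rw [submatrix_apply, id, c2 _ (Fin.succ_ne_zero x), mul_zero]
      have fss : ∀ i j, (D * emb Fin.succ Q) (Fin.succ i) (Fin.succ j) =
          (P * C.submatrix Fin.succ Fin.succ * Q) i j := by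
        intro i j
        have h1 : P * C.submatrix Fin.succ Fin.succ = D.submatrix Fin.succ Fin.succ := by
          ext p q
          exact (congrFun (congrFun a1 p) q.succ).symm
        rw [h1]
        exact congrFun (congrFun b1 i.succ) j
      have dss : ∀ i j, Dv (C 0 0) ((P * C.submatrix Fin.succ Fin.succ * Q) i j) := fun i j =>
        dv_mul_right _ _ _ (dv_mul_left G _ _ (fun p q => h4 _ _) i) _
      generalize D * emb Fin.succ Q = F at *
      constructor
      · intro i j hij
        induction i using Fin.cases with
        | zero =>
          induction j using Fin.cases with
          | zero => exact absurd rfl hij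
          | succ j => exact f0s j
        | succ i =>
          induction j using Fin.cases with
          | zero => exact fs0 i
          | succ j => rw [fss]; exact k1 i j (by simpa using hij)
      · intro i j i' j' hij hij' hii
        induction i' using Fin.cases with
        | zero => simp at hii
        | succ i' =>
          induction j' using Fin.cases with
          | zero => simp at hij'
          | succ j' =>
            rw [fss]
            induction i using Fin.cases with
            | zero =>
              induction j using Fin.cases with
              | zero => rw [f00]; exact dss _ _
              | succ j => simp at hij
            | succ i =>
              induction j using Fin.cases with
              | zero => simp at hij
              | succ j =>
                rw [fss]
                exact k2 i j i' j' (by simpa using hij) (by simpa using hij') (by simpa using hii)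

end mat
end BDuo

/-- If `R` is a Bézout duo-domain such that `R/aR` has stable range 1
for every nonzero `a`, then `R` is an elementary divisor ring. -/
theorem stmt10 (R : Type*) [Ring R] [IsDomain R]
    (hB : IsBezoutRing R) (hD : IsDuoRing R)
    (h : ∀ a : R, a ≠ 0 → HasStableRange1 (QuotBy a)) :
    ElementaryDivisorRing R := by
  have G := BDuo.good_of hB hD h
  intro m n A
  obtain ⟨P, Q, hP, hQ, h1, h2⟩ := BDuo.diag G m n A
  refine ⟨P, Q, hP, hQ, h1, fun i j i' j' e1 e2 e3 x y => ?_⟩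
  obtain ⟨u, hu⟩ := ((h2 i j i' j' e1 e2 e3).mull G x).mulr y
  obtain ⟨v, hv⟩ := G.d2 ((P * A * Q) i j) u
  exact ⟨⟨u, hu⟩, ⟨v, hu.trans hv⟩⟩
end
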